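/- arXiv:0712.0220 — 4 statements merged into one kernel-verified Lean document; each statement's English description precedes it below -/
import Mathlib

section
/- If a finite ergodic Markov chain with transition matrix P on a state space of size N has uniform stationary distribution, then for every integer T ≥ 0, both A_T and A_T^* are at most 2·∑_{j=0}^{T} (j+1)·max_{u,v} P^j(u,v). -/
open Finset

/-- `GreenFn P T u v = ∑_{i=0}^T P^i(u,v)`. -/
noncomputable def GreenFn {S : Type*} [Fintype S] [DecidableEq S]
    (P : Matrix S S ℝ) (T : ℕ) : Matrix S S ℝ :=
  ∑ i ∈ Finset.range (T + 1), P ^ i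

/-- `Acoll P T = max_u ∑_v G_T(u,v)²`. -/
noncomputable def Acoll {S : Type*} [Fintype S] [DecidableEq S]
    (P : Matrix S S ℝ) (T : ℕ) : ℝ :=
  ⨆ u, ∑ v, (GreenFn P T u v) ^ 2

/-- `AcollStar P T = max_u ∑_v G_T(v,u)²`. -/
noncomputable def AcollStar {S : Type*} [Fintype S] [DecidableEq S]
    (P : Matrix S S ℝ) (T : ℕ) : ℝ :=
  ⨆ u, ∑ v, (GreenFn P T v u) ^ 2

/-- If `a 0, a 1, …` are probability vectors with `a i ≤ M i` pointwise, then the squared `ℓ²` norm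
of their partial sum is at most `2 * ∑ j, (j + 1) * M j`. -/
theorem sum_sq_sum_range_le {S : Type*} [Fintype S] [Nonempty S] (a : ℕ → S → ℝ) (M : ℕ → ℝ)
    (ha : ∀ i v, 0 ≤ a i v) (hsum : ∀ i, ∑ v, a i v = 1) (hM : ∀ i v, a i v ≤ M i) (n : ℕ) :
    ∑ v, (∑ i ∈ Finset.range n, a i v) ^ 2 ≤
      2 * ∑ j ∈ Finset.range n, ((j : ℝ) + 1) * M j := by
  induction n with
  | zero => simp
  | succ n ih =>
    have hMn : 0 ≤ M n := (ha n (Classical.arbitrary S)).trans (hM n _)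
    have hmass : ∑ v, ∑ i ∈ Finset.range n, a i v = n := by
      rw [Finset.sum_comm]
      simp [hsum]
    have hstep : ∑ v, (∑ i ∈ Finset.range (n + 1), a i v) ^ 2 ≤
        ∑ v, ((∑ i ∈ Finset.range n, a i v) ^ 2 +
          M n * (2 * ∑ i ∈ Finset.range n, a i v + a n v)) := by
      refine Finset.sum_le_sum fun v _ => ?_
      have hs : 0 ≤ ∑ i ∈ Finset.range n, a i v := Finset.sum_nonneg fun i _ => ha i v
      rw [Finset.sum_range_succ]
      nlinarith [mul_le_mul_of_nonneg_right (hM n v)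
        (add_nonneg (mul_nonneg zero_le_two hs) (ha n v))]
    rw [Finset.sum_add_distrib, ← Finset.mul_sum, Finset.sum_add_distrib, ← Finset.mul_sum,
      hmass, hsum] at hstep
    rw [Finset.sum_range_succ]
    linarith

theorem pow_apply_le_iSup_iSup {S : Type*} [Fintype S] [DecidableEq S] (P : Matrix S S ℝ)
    (j : ℕ) (u v : S) : (P ^ j) u v ≤ ⨆ u, ⨆ v, (P ^ j) u v :=
  (le_ciSup (Set.finite_range fun v => (P ^ j) u v).bddAbove v).trans
    (le_ciSup (Set.finite_range fun u => ⨆ v, (P ^ j) u v).bddAbove u)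

theorem Acoll_le_of_uniform_stationary
    {S : Type*} [Fintype S] [DecidableEq S] [Nonempty S]
    (P : Matrix S S ℝ)
    (hnonneg : ∀ u v, 0 ≤ P u v)
    (hrow : ∀ u, ∑ v, P u v = 1)
    (hcol : ∀ v, ∑ u, P u v = 1)
    (hergodic : ∃ n : ℕ, ∀ u v, 0 < (P ^ n) u v)
    (N : ℕ) (hN : N = Fintype.card S)
    (T : ℕ) :
    Acoll P T ≤ 2 * ∑ j ∈ Finset.range (T + 1), ((j : ℝ) + 1) * (⨆ u, ⨆ v, (P ^ j) u v) ∧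
    AcollStar P T ≤ 2 * ∑ j ∈ Finset.range (T + 1), ((j : ℝ) + 1) * (⨆ u, ⨆ v, (P ^ j) u v) := by
  have hpow (j : ℕ) : P ^ j ∈ doublyStochastic ℝ S :=
    pow_mem (mem_doublyStochastic_iff_sum.2 ⟨hnonneg, hrow, hcol⟩) j
  have hG (u v : S) : GreenFn P T u v = ∑ i ∈ Finset.range (T + 1), (P ^ i) u v := by
    rw [GreenFn, Matrix.sum_apply]
  constructor
  · refine ciSup_le fun u => ?_
    simp only [hG]
    exact sum_sq_sum_range_le (fun i v => (P ^ i) u v) _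
      (fun i v => nonneg_of_mem_doublyStochastic (hpow i))
      (fun i => sum_row_of_mem_doublyStochastic (hpow i) u)
      (fun i v => pow_apply_le_iSup_iSup P i u v) (T + 1)
  · refine ciSup_le fun u => ?_
    simp only [hG]
    exact sum_sq_sum_range_le (fun i v => (P ^ i) v u) _
      (fun i v => nonneg_of_mem_doublyStochastic (hpow i))
      (fun i => sum_col_of_mem_doublyStochastic (hpow i) u)
      (fun i v => pow_apply_le_iSup_iSup P i v u) (T + 1)
end

section
/- Let P be a doubly stochastic ergodic transition matrix on a finite state space of size N, let T be an integer such that m/N ≤ P^T(u,v) ≤ M/N for all states u,v (where 0 < m ≤ 1 ≤ M), and let L ≥ 0 be an integer. Then the self-intersection count S = ∑_{i=0}^{L} ∑_{j=i+2T}^{L+2T} 1{X_i = X_j} satisfies E[S] ≥ (m/N)·C(L+2, 2), where C(L+2,2) = (L+1)(L+2)/2, for any starting state. -/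
open MeasureTheory Finset

/-- The trajectory `X` is (in law) a Markov chain with transition matrix `P` under the
probability measure `μ`. -/
def IsMarkovTraj {S Ω : Type*} [MeasurableSpace Ω]
    (μ : Measure Ω) (P : Matrix S S ℝ) (X : ℕ → Ω → S) : Prop :=
  ∀ (n : ℕ) (y : ℕ → S),
    (μ {ω | ∀ i ≤ n + 1, X i ω = y i}).toReal
      = P (y n) (y (n + 1)) * (μ {ω | ∀ i ≤ n, X i ω = y i}).toReal

/-- The self-intersection count `S = ∑_{i=0}^{L} ∑_{j=i+2T}^{L+2T} 1{X_i = X_j}`. -/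
noncomputable def collCount {S Ω : Type*} [DecidableEq S]
    (X : ℕ → Ω → S) (T L : ℕ) (ω : Ω) : ℝ :=
  ∑ i ∈ Finset.range (L + 1), ∑ j ∈ Finset.Icc (i + 2 * T) (L + 2 * T),
    if X i ω = X j ω then 1 else 0

/-- Law of total probability for a finite-valued random variable `Y`. -/
lemma measureReal_eq_sum_inter_fiber {ι Ω : Type*} [Fintype ι] [MeasurableSpace Ω]
    (μ : Measure Ω) [IsFiniteMeasure μ] {Y : Ω → ι} (hY : ∀ z, MeasurableSet {ω | Y ω = z})
    (B : Set Ω) :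
    μ.real B = ∑ z, μ.real {ω | ω ∈ B ∧ Y ω = z} := by
  classical
  have h := sum_measureReal_preimage_singleton (μ := μ.restrict B) (f := Y) Finset.univ
    (fun z _ => hY z)
  rw [Finset.coe_univ, Set.preimage_univ, measureReal_restrict_apply_univ] at h
  rw [← h]
  refine Finset.sum_congr rfl fun z _ => ?_
  rw [measureReal_restrict_apply (show MeasurableSet (Y ⁻¹' {z}) from hY z)]
  congr 1
  ext ω
  exact and_comm

/-- A lower bound for the entries of `P ^ T` persists for all later powers of a row-stochastic
matrix. -/
lemma le_pow_apply_of_le_pow_apply {S : Type*} [Fintype S] [DecidableEq S] {P : Matrix S S ℝ}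
    (hnonneg : ∀ u v, 0 ≤ P u v) (hrow : ∀ u, ∑ v, P u v = 1) {T : ℕ} {c : ℝ}
    (hc : ∀ u v, c ≤ (P ^ T) u v) {t : ℕ} (ht : T ≤ t) (u v : S) : c ≤ (P ^ t) u v := by
  induction t, ht using Nat.le_induction generalizing u with
  | base => exact hc u v
  | succ t _ ih =>
    rw [pow_succ', Matrix.mul_apply]
    calc c = ∑ w, P u w * c := by rw [← Finset.sum_mul, hrow, one_mul]
      _ ≤ ∑ w, P u w * (P ^ t) w v :=
        Finset.sum_le_sum fun w _ => mul_le_mul_of_nonneg_left (ih w) (hnonneg u w)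

namespace IsMarkovTraj

variable {S Ω : Type*} [MeasurableSpace Ω] {μ : Measure Ω} {P : Matrix S S ℝ} {X : ℕ → Ω → S}

/-- Transition rule given the full past, indexed by finite paths. -/
lemma measureReal_path_step (h : IsMarkovTraj μ P X) (n : ℕ) (z : Fin (n + 1) → S) (b : S) :
    μ.real {ω | X (n + 1) ω = b ∧ (fun k : Fin (n + 1) => X k ω) = z}
      = P (z (Fin.last n)) b * μ.real {ω | (fun k : Fin (n + 1) => X k ω) = z} := by
  have key := h n fun k => if hk : k < n + 1 then z ⟨k, hk⟩ else b
  simp only [lt_add_iff_pos_right, zero_lt_one, dif_pos, lt_self_iff_false, dif_neg,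
    not_false_eq_true] at key
  have past : ∀ ω, (∀ i ≤ n, X i ω = if hk : i < n + 1 then z ⟨i, hk⟩ else b) ↔
      (fun k : Fin (n + 1) => X k ω) = z := by
    intro ω
    rw [funext_iff]
    refine ⟨fun H k => ?_, fun H i hi => ?_⟩
    · rw [H k (Nat.lt_succ_iff.mp k.2), dif_pos k.2]
    · rw [dif_pos (Nat.lt_succ_iff.mpr hi)]
      exact H ⟨i, Nat.lt_succ_iff.mpr hi⟩
  have full : ∀ ω, (∀ i ≤ n + 1, X i ω = if hk : i < n + 1 then z ⟨i, hk⟩ else b) ↔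
      X (n + 1) ω = b ∧ (fun k : Fin (n + 1) => X k ω) = z := by
    intro ω
    rw [← past]
    refine ⟨fun H => ⟨by simpa using H (n + 1) le_rfl, fun i hi => H i (by omega)⟩, ?_⟩
    rintro ⟨hb, H⟩ i hi
    rcases Nat.le_succ_iff.mp hi with hi | rfl
    · exact H i hi
    · simpa using hb
  simp only [past, full] at key
  exact key

variable [Fintype S] [MeasurableSpace S] [MeasurableSingletonClass S] [IsFiniteMeasure μ]

/-- One-step Chapman–Kolmogorov equation for the joint law of `X i` and `X (n + 1)`. -/
lemma measureReal_pair_succ (h : IsMarkovTraj μ P X) (hmeas : ∀ n, Measurable (X n))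
    {i n : ℕ} (hin : i ≤ n) (x b : S) :
    μ.real {ω | X i ω = x ∧ X (n + 1) ω = b}
      = ∑ a, μ.real {ω | X i ω = x ∧ X n ω = a} * P a b := by
  classical
  have hpath : ∀ z, MeasurableSet {ω | (fun k : Fin (n + 1) => X k ω) = z} := fun z =>
    measurable_pi_lambda _ (fun k : Fin (n + 1) => hmeas k) (measurableSet_singleton z)
  have split : ∀ (p : Ω → Prop) (z : Fin (n + 1) → S),
      μ.real {ω | (X i ω = x ∧ p ω) ∧ (fun k : Fin (n + 1) => X k ω) = z}
        = if z ⟨i, Nat.lt_succ_iff.mpr hin⟩ = x then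
            μ.real {ω | p ω ∧ (fun k : Fin (n + 1) => X k ω) = z} else 0 := by
    intro p z
    split_ifs with hz
    · congr 1
      ext ω
      simp only [Set.mem_ofPred_eq]
      refine ⟨fun H => ⟨H.1.2, H.2⟩, fun H => ⟨⟨?_, H.1⟩, H.2⟩⟩
      rw [← hz, ← H.2]
    · convert measureReal_empty
      ext ω
      simp only [Set.mem_ofPred_eq, Set.mem_empty_iff_false, iff_false]
      rintro ⟨⟨hx, -⟩, rfl⟩
      exact hz hx
  have last : ∀ (a : S) (z : Fin (n + 1) → S),
      μ.real {ω | X n ω = a ∧ (fun k : Fin (n + 1) => X k ω) = z}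
        = if z (Fin.last n) = a then
            μ.real {ω | (fun k : Fin (n + 1) => X k ω) = z} else 0 := by
    intro a z
    split_ifs with hz
    · congr 1
      ext ω
      simp only [Set.mem_ofPred_eq, and_iff_right_iff_imp]
      rintro rfl
      exact hz
    · convert measureReal_empty
      ext ω
      simp only [Set.mem_ofPred_eq, Set.mem_empty_iff_false, iff_false]
      rintro ⟨hx, rfl⟩
      exact hz hx
  rw [measureReal_eq_sum_inter_fiber μ hpath]
  simp_rw [measureReal_eq_sum_inter_fiber μ hpath {ω | X i ω = x ∧ X n ω = _},
    Set.mem_ofPred_eq, Finset.sum_mul]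
  rw [Finset.sum_comm]
  refine Finset.sum_congr rfl fun z _ => ?_
  simp only [split, last, h.measureReal_path_step]
  split_ifs
  · simp [mul_comm]
  · simp

/-- Joint law of the chain at two times. -/
lemma measureReal_pair [DecidableEq S] (h : IsMarkovTraj μ P X) (hmeas : ∀ n, Measurable (X n))
    (i k : ℕ) (x b : S) :
    μ.real {ω | X i ω = x ∧ X (i + k) ω = b} = μ.real {ω | X i ω = x} * (P ^ k) x b := by
  induction k generalizing b with
  | zero =>
    rw [pow_zero, Matrix.one_apply, add_zero]
    split_ifs with hxb
    · simp [hxb]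
    · rw [mul_zero]
      convert measureReal_empty
      ext ω
      simp only [Set.mem_ofPred_eq, Set.mem_empty_iff_false, iff_false]
      rintro ⟨rfl, rfl⟩
      exact hxb rfl
  | succ k ih =>
    rw [← add_assoc, h.measureReal_pair_succ hmeas (Nat.le_add_right i k), pow_succ,
      Matrix.mul_apply, Finset.mul_sum]
    exact Finset.sum_congr rfl fun a _ => by rw [ih, mul_assoc]

/-- A lower bound on the return probabilities bounds the collision probability from below. -/
lemma le_measureReal_collision [DecidableEq S] {ν : Measure Ω} [IsProbabilityMeasure ν]
    (h : IsMarkovTraj ν P X) (hmeas : ∀ n, Measurable (X n)) {c : ℝ} {k : ℕ}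
    (hc : ∀ x, c ≤ (P ^ k) x x) (i : ℕ) :
    c ≤ ν.real {ω | X i ω = X (i + k) ω} := by
  have hfib : ∀ z, MeasurableSet {ω | X i ω = z} := fun z => hmeas i (measurableSet_singleton z)
  have total : ∑ x, ν.real {ω | X i ω = x} = 1 := by
    simpa using (measureReal_eq_sum_inter_fiber ν hfib Set.univ).symm
  rw [measureReal_eq_sum_inter_fiber ν hfib]
  calc c = ∑ x, ν.real {ω | X i ω = x} * c := by rw [← Finset.sum_mul, total, one_mul]
    _ ≤ ∑ x, ν.real {ω | X i ω = x} * (P ^ k) x x :=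
      Finset.sum_le_sum fun x _ => mul_le_mul_of_nonneg_left (hc x) measureReal_nonneg
    _ = _ := by
      refine Finset.sum_congr rfl fun x _ => ?_
      rw [← h.measureReal_pair hmeas]
      congr 1
      ext ω
      simp only [Set.mem_ofPred_eq]
      exact ⟨fun H => ⟨H.1.trans H.2.symm, H.1⟩, fun H => ⟨H.2, H.1.symm.trans H.2⟩⟩

end IsMarkovTraj

/-- The expected self-intersection count is the sum of the collision probabilities. -/
lemma integral_collCount {S Ω : Type*} [Fintype S] [DecidableEq S] [MeasurableSpace S]
    [MeasurableSingletonClass S] [MeasurableSpace Ω] (μ : Measure Ω) [IsFiniteMeasure μ]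
    {X : ℕ → Ω → S} (hmeas : ∀ n, Measurable (X n)) (T L : ℕ) :
    ∫ ω, collCount X T L ω ∂μ = ∑ i ∈ Finset.range (L + 1),
      ∑ j ∈ Finset.Icc (i + 2 * T) (L + 2 * T), μ.real {ω | X i ω = X j ω} := by
  have hcoll : ∀ i j, MeasurableSet {ω | X i ω = X j ω} := fun i j =>
    measurableSet_eq_fun (hmeas i) (hmeas j)
  have hind : ∀ i j, (fun ω => if X i ω = X j ω then (1 : ℝ) else 0)
      = {ω | X i ω = X j ω}.indicator 1 := fun i j => by
    ext ω
    simp [Set.indicator_apply]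
  have hint : ∀ i j, Integrable (fun ω => if X i ω = X j ω then (1 : ℝ) else 0) μ := fun i j => by
    rw [hind]
    exact (integrable_const 1).indicator (hcoll i j)
  unfold collCount
  rw [integral_finsetSum _ fun i _ => integrable_finsetSum _ fun j _ => hint i j]
  refine Finset.sum_congr rfl fun i _ => ?_
  rw [integral_finsetSum _ fun j _ => hint i j]
  refine Finset.sum_congr rfl fun j _ => ?_
  rw [hind, integral_indicator_one (hcoll i j)]

/-- The number of index pairs in the self-intersection count is `(L + 1) (L + 2) / 2`. -/
lemma sum_range_card_Icc (T L : ℕ) :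
    ∑ i ∈ Finset.range (L + 1), (#(Finset.Icc (i + 2 * T) (L + 2 * T)) : ℝ)
      = ((L : ℝ) + 1) * ((L : ℝ) + 2) / 2 := by
  have hcard : ∀ i ∈ Finset.range (L + 1),
      (#(Finset.Icc (i + 2 * T) (L + 2 * T)) : ℝ) = ((L + 1 - 1 - i : ℕ) : ℝ) + 1 := by
    intro i hi
    rw [Finset.mem_range] at hi
    rw [Nat.card_Icc]
    norm_cast
    omega
  rw [Finset.sum_congr rfl hcard, Finset.sum_range_reflect (fun i : ℕ => (i : ℝ) + 1)]
  clear hcard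
  induction L with
  | zero => norm_num
  | succ L ih =>
    rw [Finset.sum_range_succ, ih]
    push_cast
    ring

theorem first_moment_self_intersections
    {S : Type*} [Fintype S] [DecidableEq S] [Nonempty S]
    [MeasurableSpace S] [MeasurableSingletonClass S]
    {Ω : Type*} [MeasurableSpace Ω] (μ : Measure Ω) [IsProbabilityMeasure μ]
    (P : Matrix S S ℝ)
    (hnonneg : ∀ u v, 0 ≤ P u v)
    (hrow : ∀ u, ∑ v, P u v = 1)
    (hcol : ∀ v, ∑ u, P u v = 1)
    (hergodic : ∃ n : ℕ, ∀ u v, 0 < (P ^ n) u v)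
    (N : ℕ) (hN : N = Fintype.card S)
    (T : ℕ) (m M : ℝ) (hm0 : 0 < m) (hm1 : m ≤ 1) (hM : 1 ≤ M)
    (hPT : ∀ u v, m / N ≤ (P ^ T) u v ∧ (P ^ T) u v ≤ M / N)
    (L : ℕ)
    (x0 : S) (X : ℕ → Ω → S)
    (hmeas : ∀ n, Measurable (X n))
    (hstart : μ {ω | X 0 ω = x0} = 1)
    (hmarkov : IsMarkovTraj μ P X) :
    m / N * (((L : ℝ) + 1) * ((L : ℝ) + 2) / 2) ≤ ∫ ω, collCount X T L ω ∂μ := by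
  have hcoll : ∀ i, ∀ j ∈ Finset.Icc (i + 2 * T) (L + 2 * T),
      m / N ≤ μ.real {ω | X i ω = X j ω} := by
    intro i j hj
    rw [Finset.mem_Icc] at hj
    obtain ⟨k, rfl⟩ := Nat.exists_eq_add_of_le (show i ≤ j by omega)
    exact hmarkov.le_measureReal_collision hmeas (fun x =>
      le_pow_apply_of_le_pow_apply hnonneg hrow (fun u v => (hPT u v).1) (by omega) x x) i
  rw [integral_collCount μ hmeas, ← sum_range_card_Icc T L, Finset.mul_sum]
  refine Finset.sum_le_sum fun i _ => ?_
  rw [mul_comm, ← nsmul_eq_mul]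
  exact Finset.card_nsmul_le_sum _ _ _ (hcoll i)
end

section
/- Let P be a doubly stochastic ergodic transition matrix on a finite state space of size N, let T be an integer such that m/N ≤ P^T(u,v) ≤ M/N for all states u,v (where 0 < m ≤ 1 ≤ M), and let L ≥ 0 be an integer. Then the self-intersection count S = ∑_{i=0}^{L} ∑_{j=i+2T}^{L+2T} 1{X_i = X_j} satisfies E[S²] ≤ (M/N)²·C(L+2,2)² + 2·(M/N)·C(L+2,2)·(A_T + √(A_T·A_T^*)), where C(L+2,2) = (L+1)(L+2)/2, for any starting state. -/
open MeasureTheory Finset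

/-- A function of the trajectory up to time `n` is a sum over the possible trajectories. -/
lemma DependsOn.eq_sum_cylinder {S : Type*} [Fintype S] [DecidableEq S]
    {n : ℕ} {φ : (ℕ → S) → ℝ} (hφ : DependsOn φ (Set.Iic n)) (x : ℕ → S) :
    φ x = ∑ z : Fin (n + 1) → S,
      Set.indicator {x : ℕ → S | ∀ i ≤ n, x i = z (Fin.ofNat (n + 1) i)} 1 x *
        φ (fun i => z (Fin.ofNat (n + 1) i)) := by
  have hmod : ∀ i ≤ n, i % (n + 1) = i := fun i hi => Nat.mod_eq_of_lt (by lia)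
  rw [Finset.sum_eq_single (fun i : Fin (n + 1) => x i)]
  · rw [Set.indicator_of_mem]
    · simp only [Pi.one_apply, one_mul]
      refine hφ fun i hi => ?_
      simp [hmod i hi]
    · intro i hi
      simp [hmod i hi]
  · intro z _ hz
    rw [Set.indicator_of_notMem, zero_mul]
    intro h
    refine hz (funext fun i => ?_)
    have := h i (by lia)
    rw [this]
    congr 1
    ext
    simp
  · simp

lemma measurableSet_cylinder {S Ω : Type*} [MeasurableSpace S] [MeasurableSingletonClass S]
    [MeasurableSpace Ω] {X : ℕ → Ω → S} (hmeas : ∀ n, Measurable (X n)) (n : ℕ)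
    (y : ℕ → S) :
    MeasurableSet {ω | ∀ i ≤ n, X i ω = y i} := by
  have : {ω | ∀ i ≤ n, X i ω = y i} = ⋂ i ∈ Set.Iic n, X i ⁻¹' {y i} := by
    ext; simp
  rw [this]
  exact MeasurableSet.biInter (Set.to_countable _) fun i _ => hmeas i (measurableSet_singleton _)

section Trajectory

variable {S Ω : Type*} [Fintype S] [DecidableEq S] [MeasurableSpace S]
  [MeasurableSingletonClass S] [MeasurableSpace Ω] {μ : Measure Ω} [IsProbabilityMeasure μ]
  {P : Matrix S S ℝ} {X : ℕ → Ω → S}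

lemma integrable_comp_traj (hmeas : ∀ n, Measurable (X n)) {n : ℕ} {φ : (ℕ → S) → ℝ}
    (hφ : DependsOn φ (Set.Iic n)) : Integrable (fun ω => φ (fun i => X i ω)) μ := by
  simp_rw [fun ω => hφ.eq_sum_cylinder (fun i => X i ω)]
  refine integrable_finsetSum _ fun z _ => Integrable.mul_const ?_ _
  exact (integrable_indicator_iff (measurableSet_cylinder hmeas n _)).2
    (integrable_const (1 : ℝ)).integrableOn

lemma integral_comp_traj (hmeas : ∀ n, Measurable (X n)) {n : ℕ} {φ : (ℕ → S) → ℝ}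
    (hφ : DependsOn φ (Set.Iic n)) :
    ∫ ω, φ (fun i => X i ω) ∂μ = ∑ z : Fin (n + 1) → S,
      μ.real {ω | ∀ i ≤ n, X i ω = z (Fin.ofNat (n + 1) i)} *
        φ (fun i => z (Fin.ofNat (n + 1) i)) := by
  simp_rw [fun ω => hφ.eq_sum_cylinder (fun i => X i ω)]
  have hind (z : Fin (n + 1) → S) : (fun ω =>
      Set.indicator {x : ℕ → S | ∀ i ≤ n, x i = z (Fin.ofNat (n + 1) i)} (1 : (ℕ → S) → ℝ)
        (fun i => X i ω)) =
      Set.indicator {ω | ∀ i ≤ n, X i ω = z (Fin.ofNat (n + 1) i)} 1 := rfl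
  rw [integral_finsetSum]
  · refine Finset.sum_congr rfl fun z _ => ?_
    rw [integral_mul_const, hind, integral_indicator_one (measurableSet_cylinder hmeas n _)]
  · refine fun z _ => Integrable.mul_const ?_ _
    exact (integrable_indicator_iff (measurableSet_cylinder hmeas n _)).2
      (integrable_const (1 : ℝ)).integrableOn

lemma integral_traj_mono (hmeas : ∀ n, Measurable (X n)) {n : ℕ} {φ ψ : (ℕ → S) → ℝ}
    (hφ : DependsOn φ (Set.Iic n)) (hψ : DependsOn ψ (Set.Iic n)) (h : ∀ y, φ y ≤ ψ y) :
    ∫ ω, φ (fun i => X i ω) ∂μ ≤ ∫ ω, ψ (fun i => X i ω) ∂μ :=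
  integral_mono (integrable_comp_traj hmeas hφ) (integrable_comp_traj hmeas hψ) fun _ => h _

lemma integral_traj_le_const (hmeas : ∀ n, Measurable (X n)) {n : ℕ} {φ : (ℕ → S) → ℝ}
    (hφ : DependsOn φ (Set.Iic n)) {c : ℝ} (h : ∀ y, φ y ≤ c) :
    ∫ ω, φ (fun i => X i ω) ∂μ ≤ c := by
  refine (integral_traj_mono hmeas hφ (ψ := fun _ => c) (fun _ _ _ => rfl) h).trans ?_
  simp

/-- The Markov property over one step. -/
lemma IsMarkovTraj.integral_succ (hX : IsMarkovTraj μ P X) (hmeas : ∀ n, Measurable (X n))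
    {n : ℕ} {Φ : (ℕ → S) → S → ℝ} (hΦ : DependsOn Φ (Set.Iic n)) :
    ∫ ω, Φ (fun i => X i ω) (X (n + 1) ω) ∂μ
      = ∫ ω, ∑ s, P (X n ω) s * Φ (fun i => X i ω) s ∂μ := by
  have hψ : DependsOn (fun y : ℕ → S => ∑ s, P (y n) s * Φ y s) (Set.Iic n) := by
    intro y y' h
    simp only [hΦ h, h n (by simp)]
  rw [integral_comp_traj hmeas hψ]
  have hsplit : ∀ ω, Φ (fun i => X i ω) (X (n + 1) ω) = ∑ s,
      (if X (n + 1) ω = s then (1 : ℝ) else 0) * Φ (fun i => X i ω) s := by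
    intro ω; simp
  have hcyl (s : S) (y : ℕ → S) : {ω | X (n + 1) ω = s ∧ ∀ i ≤ n, X i ω = y i}
      = {ω | ∀ i ≤ n + 1, X i ω = Function.update y (n + 1) s i} := by
    ext ω
    constructor
    · rintro ⟨h, h'⟩ i hi
      rcases Nat.lt_or_ge n i with hin | hin
      · obtain rfl : i = n + 1 := by lia
        simpa using h
      · rw [Function.update_of_ne (by lia)]
        exact h' i hin
    · intro h
      refine ⟨by simpa using h (n + 1) le_rfl, fun i hi => ?_⟩
      have := h i (by lia)
      rwa [Function.update_of_ne (by lia)] at this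
  have hstep (s : S) (y : ℕ → S) : μ.real {ω | X (n + 1) ω = s ∧ ∀ i ≤ n, X i ω = y i}
      = P (y n) s * μ.real {ω | ∀ i ≤ n, X i ω = y i} := by
    rw [hcyl, measureReal_def, hX n, Function.update_self, Function.update_of_ne (by lia),
      measureReal_def]
    congr 4
    ext ω
    refine forall₂_congr fun i hi => ?_
    rw [Function.update_of_ne (by lia)]
  simp_rw [hsplit]
  have hexp (s : S) (ω : Ω) : (if X (n + 1) ω = s then (1 : ℝ) else 0) * Φ (fun i => X i ω) s
      = ∑ z : Fin (n + 1) → S,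
        Set.indicator {ω | X (n + 1) ω = s ∧ ∀ i ≤ n, X i ω = z (Fin.ofNat (n + 1) i)} 1 ω *
          Φ (fun i => z (Fin.ofNat (n + 1) i)) s := by
    have hs : DependsOn (fun y => Φ y s) (Set.Iic n) := fun y y' h => by simp only [hΦ h]
    rw [hs.eq_sum_cylinder (fun i => X i ω), Finset.mul_sum]
    refine Finset.sum_congr rfl fun z _ => ?_
    by_cases h : X (n + 1) ω = s <;> simp [h, Set.indicator_apply]
  have hcylm (s : S) (z : Fin (n + 1) → S) : MeasurableSet
      {ω | X (n + 1) ω = s ∧ ∀ i ≤ n, X i ω = z (Fin.ofNat (n + 1) i)} :=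
    (hmeas (n + 1) (measurableSet_singleton s)).inter
      (measurableSet_cylinder hmeas n fun i => z (Fin.ofNat (n + 1) i))
  have hinteg' (s : S) (z : Fin (n + 1) → S) : Integrable (fun ω =>
      Set.indicator {ω | X (n + 1) ω = s ∧ ∀ i ≤ n, X i ω = z (Fin.ofNat (n + 1) i)} 1 ω *
          Φ (fun i => z (Fin.ofNat (n + 1) i)) s) μ :=
    Integrable.mul_const ((integrable_indicator_iff (hcylm s z)).2
      (integrable_const (1 : ℝ)).integrableOn) _
  simp_rw [hexp]
  rw [integral_finsetSum _ fun s _ => integrable_finsetSum _ fun z _ => hinteg' s z]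
  simp_rw [fun s => integral_finsetSum Finset.univ fun z _ => hinteg' s z]
  rw [Finset.sum_comm]
  refine Finset.sum_congr rfl fun z _ => ?_
  rw [Finset.mul_sum]
  refine Finset.sum_congr rfl fun s _ => ?_
  rw [integral_mul_const, integral_indicator_one (hcylm s z),
    hstep s fun i => z (Fin.ofNat (n + 1) i)]
  ring

/-- The Markov property over several steps. -/
lemma IsMarkovTraj.integral_eq (hX : IsMarkovTraj μ P X) (hmeas : ∀ n, Measurable (X n))
    {n m : ℕ} (hnm : n ≤ m) {Φ : (ℕ → S) → S → ℝ} (hΦ : DependsOn Φ (Set.Iic n)) :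
    ∫ ω, Φ (fun i => X i ω) (X m ω) ∂μ
      = ∫ ω, ∑ s, (P ^ (m - n)) (X n ω) s * Φ (fun i => X i ω) s ∂μ := by
  induction m, hnm using Nat.le_induction generalizing Φ with
  | base => simp [Matrix.one_apply]
  | succ m hm ih =>
    have hΦm : DependsOn Φ (Set.Iic m) := fun y y' h => hΦ fun i hi => h i (le_trans hi hm)
    have hΦ' : DependsOn (fun y u => ∑ s, P u s * Φ y s) (Set.Iic n) := by
      intro y y' h
      simp only [hΦ h]
    rw [hX.integral_succ hmeas hΦm, ih hΦ']
    congr with ω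
    rw [Nat.succ_sub hm, pow_succ]
    simp_rw [Matrix.mul_apply, Finset.sum_mul, Finset.mul_sum]
    rw [Finset.sum_comm]
    simp_rw [mul_assoc]

end Trajectory

section Stochastic

variable {S : Type*} [Fintype S] [DecidableEq S] {P : Matrix S S ℝ}

lemma pow_apply_nonneg (hnonneg : ∀ u v, 0 ≤ P u v) (n : ℕ) (u v : S) : 0 ≤ (P ^ n) u v := by
  induction n generalizing u v with
  | zero => rw [pow_zero, Matrix.one_apply]; split_ifs <;> simp
  | succ n ih =>
    rw [pow_succ, Matrix.mul_apply]
    exact Finset.sum_nonneg fun s _ => mul_nonneg (ih _ _) (hnonneg _ _)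

lemma sum_pow_row (hrow : ∀ u, ∑ v, P u v = 1) (n : ℕ) (u : S) : ∑ v, (P ^ n) u v = 1 := by
  induction n with
  | zero => simp [Matrix.one_apply]
  | succ n ih =>
    simp_rw [pow_succ, Matrix.mul_apply]
    rw [Finset.sum_comm]
    simp_rw [← Finset.mul_sum, hrow, mul_one, ih]

lemma sum_pow_col (hcol : ∀ v, ∑ u, P u v = 1) (n : ℕ) (v : S) : ∑ u, (P ^ n) u v = 1 := by
  have := sum_pow_row (P := P.transpose) (by simpa using hcol) n v
  simpa [← Matrix.transpose_pow] using this

lemma pow_apply_le (hnonneg : ∀ u v, 0 ≤ P u v) (hrow : ∀ u, ∑ v, P u v = 1) {T : ℕ} {c : ℝ}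
    (hT : ∀ u v, (P ^ T) u v ≤ c) {n : ℕ} (hn : T ≤ n) (u v : S) : (P ^ n) u v ≤ c := by
  obtain ⟨r, rfl⟩ := Nat.exists_eq_add_of_le' hn
  rw [pow_add, Matrix.mul_apply]
  calc ∑ s, (P ^ r) u s * (P ^ T) s v ≤ ∑ s, (P ^ r) u s * c :=
        Finset.sum_le_sum fun s _ => mul_le_mul_of_nonneg_left (hT _ _)
          (pow_apply_nonneg hnonneg _ _ _)
    _ = c := by rw [← Finset.sum_mul, sum_pow_row hrow, one_mul]

lemma sum_sum_pow_mul_pow_eq_greenFn_sq (P : Matrix S S ℝ) (T : ℕ) (u : S) :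
    ∑ a ∈ range (T + 1), ∑ b ∈ range (T + 1), ∑ s, (P ^ a) u s * (P ^ b) u s
      = ∑ s, GreenFn P T u s ^ 2 := by
  simp_rw [GreenFn, Matrix.sum_apply, sq, Finset.sum_mul_sum]
  rw [Finset.sum_comm (s := Finset.univ)]
  exact Finset.sum_congr rfl fun a _ => Finset.sum_comm

lemma sum_sum_pow_mul_pow_eq_greenFn_mul (P : Matrix S S ℝ) (T : ℕ) (u : S) :
    ∑ a ∈ range (T + 1), ∑ b ∈ range (T + 1), ∑ s, (P ^ a) u s * (P ^ b) s u
      = ∑ s, GreenFn P T u s * GreenFn P T s u := by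
  simp_rw [GreenFn, Matrix.sum_apply, Finset.sum_mul_sum]
  rw [Finset.sum_comm (s := Finset.univ)]
  exact Finset.sum_congr rfl fun a _ => Finset.sum_comm

lemma sum_greenFn_sq_le_acoll (P : Matrix S S ℝ) (T : ℕ) (u : S) :
    ∑ s, GreenFn P T u s ^ 2 ≤ Acoll P T :=
  le_ciSup (f := fun u => ∑ s, GreenFn P T u s ^ 2) (Set.finite_range _).bddAbove u

lemma sum_greenFn_sq_le_acollStar (P : Matrix S S ℝ) (T : ℕ) (u : S) :
    ∑ s, GreenFn P T s u ^ 2 ≤ AcollStar P T :=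
  le_ciSup (f := fun u => ∑ s, GreenFn P T s u ^ 2) (Set.finite_range _).bddAbove u

lemma sum_greenFn_mul_le (P : Matrix S S ℝ) (T : ℕ) (u : S) :
    ∑ s, GreenFn P T u s * GreenFn P T s u ≤ Real.sqrt (Acoll P T * AcollStar P T) := by
  refine Real.le_sqrt_of_sq_le ((Finset.sum_mul_sq_le_sq_mul_sq _ _ _).trans ?_)
  have h := sum_greenFn_sq_le_acoll P T u
  exact mul_le_mul h (sum_greenFn_sq_le_acollStar P T u) (by positivity)
    ((by positivity : (0 : ℝ) ≤ ∑ s, GreenFn P T u s ^ 2).trans h)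

end Stochastic

/-- The pairs of times `(i, j)` with `i ≤ L` and `i + 2 * T ≤ j ≤ L + 2 * T`. -/
def timePairs (T L : ℕ) : Finset (ℕ × ℕ) :=
  (range (L + 1) ×ˢ range (L + 2 * T + 1)).filter fun x => x.1 + 2 * T ≤ x.2

lemma mem_timePairs {T L : ℕ} {x : ℕ × ℕ} :
    x ∈ timePairs T L ↔ x.1 + 2 * T ≤ x.2 ∧ x.2 ≤ L + 2 * T := by
  simp only [timePairs, mem_filter, mem_product, mem_range]
  lia

lemma sum_timePairs (T L : ℕ) (f : ℕ → ℕ → ℝ) :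
    ∑ x ∈ timePairs T L, f x.1 x.2
      = ∑ i ∈ range (L + 1), ∑ j ∈ Icc (i + 2 * T) (L + 2 * T), f i j := by
  rw [timePairs, Finset.sum_filter, Finset.sum_product]
  refine Finset.sum_congr rfl fun i _ => ?_
  rw [← Finset.sum_filter]
  refine Finset.sum_congr ?_ fun _ _ => rfl
  ext j
  simp only [mem_filter, mem_range, mem_Icc]
  lia

lemma card_timePairs (T L : ℕ) :
    ((timePairs T L).card : ℝ) = ((L : ℝ) + 1) * ((L : ℝ) + 2) / 2 := by
  have h := sum_timePairs T L fun _ _ => 1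
  rw [Finset.sum_const, nsmul_one] at h
  rw [h]
  have : ∀ i ∈ range (L + 1), ∑ j ∈ Icc (i + 2 * T) (L + 2 * T), (1 : ℝ) = (L : ℝ) + 1 - i := by
    intro i hi
    have hi : i ≤ L := by simpa [Nat.lt_succ_iff] using hi
    rw [Finset.sum_const, nsmul_one, Nat.card_Icc,
      show L + 2 * T + 1 - (i + 2 * T) = L + 1 - i by lia, Nat.cast_sub (by lia)]
    simp
  rw [Finset.sum_congr rfl this, Finset.sum_sub_distrib, ← Nat.cast_sum, Finset.sum_const,
    card_range]
  have hg : ((∑ i ∈ range (L + 1), i : ℕ) : ℝ) * 2 = (L + 1) * L := by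
    exact_mod_cast Finset.sum_range_id_mul_two (L + 1)
  simp only [nsmul_eq_mul, Nat.cast_add, Nat.cast_one]
  linarith

lemma sum_timePairs_shift_le (T L a b : ℕ) {f : ℕ → ℝ} (hf : ∀ i, 0 ≤ f i) :
    ∑ x ∈ timePairs T L, ∑ y ∈ timePairs T L,
        (if y.1 = x.1 + a ∧ y.2 = x.2 + b then f x.1 else 0)
      ≤ ∑ x ∈ timePairs T L, f x.1 := by
  refine Finset.sum_le_sum fun x _ => ?_
  calc _ = ∑ y ∈ timePairs T L, if y = (x.1 + a, x.2 + b) then f x.1 else 0 := by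
        simp_rw [Prod.ext_iff]
    _ ≤ f x.1 := by
        rw [Finset.sum_ite_eq']
        split_ifs
        exacts [le_rfl, hf _]

lemma sum_timePairs_swap_shift_le (T L a b : ℕ) {f : ℕ → ℝ} (hf : ∀ i, 0 ≤ f i) :
    ∑ x ∈ timePairs T L, ∑ y ∈ timePairs T L,
        (if x.1 = y.1 + a ∧ y.2 = x.2 + b then f y.1 else 0)
      ≤ ∑ x ∈ timePairs T L, f x.1 := by
  rw [← Finset.sum_product', ← Finset.sum_filter]
  rw [← Finset.sum_image (s := ((timePairs T L) ×ˢ (timePairs T L)).filter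
      fun p => p.1.1 = p.2.1 + a ∧ p.2.2 = p.1.2 + b)
    (g := fun p : (ℕ × ℕ) × (ℕ × ℕ) => (p.2.1, p.1.2)) (f := fun z : ℕ × ℕ => f z.1)]
  · refine Finset.sum_le_sum_of_subset_of_nonneg ?_ fun _ _ _ => hf _
    intro z
    simp only [mem_image, mem_filter, mem_product, mem_timePairs]
    rintro ⟨p, hp, rfl⟩
    dsimp only
    lia
  · rintro ⟨⟨i, j⟩, ⟨k, l⟩⟩ hp ⟨⟨i', j'⟩, ⟨k', l'⟩⟩ hp' h
    simp only [coe_filter, Set.mem_ofPred_eq, Prod.mk.injEq] at hp hp' h ⊢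
    lia

section Weights

variable {S Ω : Type*} [Fintype S] [DecidableEq S] [MeasurableSpace Ω] {μ : Measure Ω}
  {P : Matrix S S ℝ} {X : ℕ → Ω → S} {T : ℕ}

lemma integral_sum_pow_mul_pow_nonneg (hnonneg : ∀ u v, 0 ≤ P u v) (a b i : ℕ) :
    0 ≤ ∫ ω, ∑ s, (P ^ a) (X i ω) s * (P ^ b) (X i ω) s ∂μ :=
  integral_nonneg fun _ => Finset.sum_nonneg fun _ _ =>
    mul_nonneg (pow_apply_nonneg hnonneg _ _ _) (pow_apply_nonneg hnonneg _ _ _)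

lemma integral_sum_pow_mul_pow_nonneg' (hnonneg : ∀ u v, 0 ≤ P u v) (a b i : ℕ) :
    0 ≤ ∫ ω, ∑ s, (P ^ a) (X i ω) s * (P ^ b) s (X i ω) ∂μ :=
  integral_nonneg fun _ => Finset.sum_nonneg fun _ _ =>
    mul_nonneg (pow_apply_nonneg hnonneg _ _ _) (pow_apply_nonneg hnonneg _ _ _)

/-- The contribution of the quadruples `(i, j, k, l)` with `i ≤ k ≤ i + T`, `j ≤ l ≤ j + T`. -/
noncomputable def forwardWeight (μ : Measure Ω) (P : Matrix S S ℝ) (X : ℕ → Ω → S) (T : ℕ)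
    (x y : ℕ × ℕ) : ℝ :=
  ∑ a ∈ range (T + 1), ∑ b ∈ range (T + 1), if y.1 = x.1 + a ∧ y.2 = x.2 + b then
    ∫ ω, ∑ s, (P ^ a) (X x.1 ω) s * (P ^ b) (X x.1 ω) s ∂μ else 0

/-- The contribution of the quadruples `(i, j, k, l)` with `k ≤ i ≤ k + T`, `j ≤ l ≤ j + T`. -/
noncomputable def backwardWeight (μ : Measure Ω) (P : Matrix S S ℝ) (X : ℕ → Ω → S) (T : ℕ)
    (x y : ℕ × ℕ) : ℝ :=
  ∑ a ∈ range (T + 1), ∑ b ∈ range (T + 1), if x.1 = y.1 + a ∧ y.2 = x.2 + b then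
    ∫ ω, ∑ s, (P ^ a) (X y.1 ω) s * (P ^ b) s (X y.1 ω) ∂μ else 0

lemma forwardWeight_nonneg (hnonneg : ∀ u v, 0 ≤ P u v) (x y : ℕ × ℕ) :
    0 ≤ forwardWeight μ P X T x y := by
  refine Finset.sum_nonneg fun a _ => Finset.sum_nonneg fun b _ => ?_
  split_ifs
  exacts [integral_sum_pow_mul_pow_nonneg hnonneg _ _ _, le_rfl]

lemma backwardWeight_nonneg (hnonneg : ∀ u v, 0 ≤ P u v) (x y : ℕ × ℕ) :
    0 ≤ backwardWeight μ P X T x y := by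
  refine Finset.sum_nonneg fun a _ => Finset.sum_nonneg fun b _ => ?_
  split_ifs
  exacts [integral_sum_pow_mul_pow_nonneg' hnonneg _ _ _, le_rfl]

lemma le_forwardWeight (hnonneg : ∀ u v, 0 ≤ P u v) {x y : ℕ × ℕ} {a b : ℕ} (ha : a ≤ T)
    (hb : b ≤ T) (h1 : y.1 = x.1 + a) (h2 : y.2 = x.2 + b) :
    ∫ ω, ∑ s, (P ^ a) (X x.1 ω) s * (P ^ b) (X x.1 ω) s ∂μ ≤ forwardWeight μ P X T x y := by
  have h0 : ∀ a b : ℕ, 0 ≤ if y.1 = x.1 + a ∧ y.2 = x.2 + b then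
      ∫ ω, ∑ s, (P ^ a) (X x.1 ω) s * (P ^ b) (X x.1 ω) s ∂μ else 0 := by
    intro a b
    split_ifs
    exacts [integral_sum_pow_mul_pow_nonneg hnonneg _ _ _, le_rfl]
  refine le_trans ?_ (Finset.single_le_sum (fun a _ => Finset.sum_nonneg fun b _ => h0 a b)
    (mem_range.2 (Nat.lt_succ_of_le ha)))
  refine le_trans ?_ (Finset.single_le_sum (fun b _ => h0 a b)
    (mem_range.2 (Nat.lt_succ_of_le hb)))
  rw [if_pos ⟨h1, h2⟩]

lemma le_backwardWeight (hnonneg : ∀ u v, 0 ≤ P u v) {x y : ℕ × ℕ} {a b : ℕ} (ha : a ≤ T)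
    (hb : b ≤ T) (h1 : x.1 = y.1 + a) (h2 : y.2 = x.2 + b) :
    ∫ ω, ∑ s, (P ^ a) (X y.1 ω) s * (P ^ b) s (X y.1 ω) ∂μ ≤ backwardWeight μ P X T x y := by
  have h0 : ∀ a b : ℕ, 0 ≤ if x.1 = y.1 + a ∧ y.2 = x.2 + b then
      ∫ ω, ∑ s, (P ^ a) (X y.1 ω) s * (P ^ b) s (X y.1 ω) ∂μ else 0 := by
    intro a b
    split_ifs
    exacts [integral_sum_pow_mul_pow_nonneg' hnonneg _ _ _, le_rfl]
  refine le_trans ?_ (Finset.single_le_sum (fun a _ => Finset.sum_nonneg fun b _ => h0 a b)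
    (mem_range.2 (Nat.lt_succ_of_le ha)))
  refine le_trans ?_ (Finset.single_le_sum (fun b _ => h0 a b)
    (mem_range.2 (Nat.lt_succ_of_le hb)))
  rw [if_pos ⟨h1, h2⟩]

end Weights

section Collisions

variable {S Ω : Type*} [Fintype S] [DecidableEq S] [MeasurableSpace S]
  [MeasurableSingletonClass S] [MeasurableSpace Ω] {μ : Measure Ω} [IsProbabilityMeasure μ]
  {P : Matrix S S ℝ} {X : ℕ → Ω → S} {T : ℕ} {c : ℝ}

lemma IsMarkovTraj.integral_le (hX : IsMarkovTraj μ P X) (hmeas : ∀ n, Measurable (X n))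
    (hnonneg : ∀ u v, 0 ≤ P u v) (hrow : ∀ u, ∑ v, P u v = 1) (hT : ∀ u v, (P ^ T) u v ≤ c)
    {n m : ℕ} (hnm : n + T ≤ m) {Φ : (ℕ → S) → S → ℝ} (hΦ : DependsOn Φ (Set.Iic n))
    (hΦ0 : ∀ y s, 0 ≤ Φ y s) :
    ∫ ω, Φ (fun i => X i ω) (X m ω) ∂μ ≤ c * ∫ ω, ∑ s, Φ (fun i => X i ω) s ∂μ := by
  rw [hX.integral_eq hmeas (by lia : n ≤ m) hΦ, ← integral_const_mul]
  refine integral_traj_mono (n := n) hmeas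
    (φ := fun y => ∑ s, (P ^ (m - n)) (y n) s * Φ y s)
    (ψ := fun y => c * ∑ s, Φ y s) ?_ ?_ fun y => ?_
  · intro y y' h
    simp only [hΦ h, h n (by simp)]
  · intro y y' h
    simp only [hΦ h]
  · refine le_of_le_of_eq ?_ (Finset.mul_sum _ _ _).symm
    exact Finset.sum_le_sum fun s _ => mul_le_mul_of_nonneg_right
      (pow_apply_le hnonneg hrow hT (by lia) _ _) (hΦ0 _ _)

lemma IsMarkovTraj.integral_collision_le (hX : IsMarkovTraj μ P X)
    (hmeas : ∀ n, Measurable (X n)) (hnonneg : ∀ u v, 0 ≤ P u v)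
    (hrow : ∀ u, ∑ v, P u v = 1) (hT : ∀ u v, (P ^ T) u v ≤ c) {i j : ℕ} (hij : i + T ≤ j) :
    ∫ ω, (if X i ω = X j ω then (1 : ℝ) else 0) ∂μ ≤ c := by
  refine (hX.integral_le hmeas hnonneg hrow hT hij
    (Φ := fun y s => if y i = s then (1 : ℝ) else 0) ?_ ?_).trans ?_
  · intro y y' h
    simp only [h i (by simp)]
  · intro y s
    positivity
  · simp

/-- Two collisions whose later times are at least `T` apart. -/
lemma IsMarkovTraj.integral_collision_mul_le_sq (hX : IsMarkovTraj μ P X)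
    (hmeas : ∀ n, Measurable (X n)) (hnonneg : ∀ u v, 0 ≤ P u v)
    (hrow : ∀ u, ∑ v, P u v = 1) (hT : ∀ u v, (P ^ T) u v ≤ c) (hc : 0 ≤ c) {i j k l : ℕ}
    (hij : i + T ≤ j) (hkl : k + T ≤ l) (hjl : j + T ≤ l) :
    ∫ ω, (if X i ω = X j ω then (1 : ℝ) else 0) * (if X k ω = X l ω then 1 else 0) ∂μ
      ≤ c ^ 2 := by
  refine (hX.integral_le hmeas hnonneg hrow hT (n := l - T) (by lia)
    (Φ := fun y s => (if y i = y j then (1 : ℝ) else 0) * if y k = s then 1 else 0) ?_ ?_).trans ?_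
  · intro y y' h
    simp only [h i (Set.mem_Iic.2 (by lia)), h j (Set.mem_Iic.2 (by lia)),
      h k (Set.mem_Iic.2 (by lia))]
  · intro y s
    positivity
  · rw [sq]
    refine mul_le_mul_of_nonneg_left ?_ hc
    simp_rw [← Finset.mul_sum]
    simpa using hX.integral_collision_le hmeas hnonneg hrow hT hij

/-- Two collisions whose earlier times both precede the later ones by at least `T`. -/
lemma IsMarkovTraj.integral_collision_mul_le (hX : IsMarkovTraj μ P X)
    (hmeas : ∀ n, Measurable (X n)) (hnonneg : ∀ u v, 0 ≤ P u v)
    (hrow : ∀ u, ∑ v, P u v = 1) (hT : ∀ u v, (P ^ T) u v ≤ c) {i j k l : ℕ}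
    (hij : i + T ≤ j) (hkj : k + T ≤ j) (hjl : j ≤ l) :
    ∫ ω, (if X i ω = X j ω then (1 : ℝ) else 0) * (if X k ω = X l ω then 1 else 0) ∂μ
      ≤ c * ∫ ω, (P ^ (l - j)) (X i ω) (X k ω) ∂μ := by
  have hstep := hX.integral_eq hmeas hjl
    (Φ := fun y s => (if y i = y j then (1 : ℝ) else 0) * if y k = s then 1 else 0) (by
      intro y y' h
      simp only [h i (Set.mem_Iic.2 (by lia)), h j (Set.mem_Iic.2 (by lia)),
        h k (Set.mem_Iic.2 (by lia))])
  have hle := hX.integral_le hmeas hnonneg hrow hT (n := j - T) (m := j) (by lia)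
    (Φ := fun y s => if y i = s then (P ^ (l - j)) (y i) (y k) else 0) (by
      intro y y' h
      simp only [h i (Set.mem_Iic.2 (by lia)), h k (Set.mem_Iic.2 (by lia))]) (by
      intro y s
      exact ite_nonneg (pow_apply_nonneg hnonneg _ _ _) le_rfl)
  rw [hstep]
  convert hle using 3 with ω ω
  · simp only [mul_ite, mul_one, mul_zero, Finset.sum_ite_eq, Finset.mem_univ, if_true]
    split_ifs with h
    · rw [h]
    · rfl
  · simp

lemma IsMarkovTraj.integral_pow_apply_eq_of_le (hX : IsMarkovTraj μ P X)
    (hmeas : ∀ n, Measurable (X n)) {i k : ℕ} (hik : i ≤ k) (b : ℕ) :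
    ∫ ω, (P ^ b) (X i ω) (X k ω) ∂μ
      = ∫ ω, ∑ s, (P ^ (k - i)) (X i ω) s * (P ^ b) (X i ω) s ∂μ :=
  hX.integral_eq hmeas hik (Φ := fun y s => (P ^ b) (y i) s) fun y y' h => by
    simp only [h i (by simp)]

lemma IsMarkovTraj.integral_pow_apply_eq_of_ge (hX : IsMarkovTraj μ P X)
    (hmeas : ∀ n, Measurable (X n)) {i k : ℕ} (hki : k ≤ i) (b : ℕ) :
    ∫ ω, (P ^ b) (X i ω) (X k ω) ∂μ
      = ∫ ω, ∑ s, (P ^ (i - k)) (X k ω) s * (P ^ b) s (X k ω) ∂μ :=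
  hX.integral_eq hmeas hki (Φ := fun y s => (P ^ b) s (y k)) fun y y' h => by
    simp only [h k (by simp)]

lemma IsMarkovTraj.integral_pow_apply_le (hX : IsMarkovTraj μ P X)
    (hmeas : ∀ n, Measurable (X n)) (hnonneg : ∀ u v, 0 ≤ P u v)
    (hrow : ∀ u, ∑ v, P u v = 1) (hcol : ∀ v, ∑ u, P u v = 1) (hT : ∀ u v, (P ^ T) u v ≤ c)
    {i k : ℕ} (hik : i + T ≤ k ∨ k + T ≤ i) (b : ℕ) :
    ∫ ω, (P ^ b) (X i ω) (X k ω) ∂μ ≤ c := by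
  rcases hik with hik | hki
  · refine (hX.integral_le hmeas hnonneg hrow hT hik (Φ := fun y s => (P ^ b) (y i) s)
      (fun y y' h => ?_) fun y s => pow_apply_nonneg hnonneg _ _ _).trans ?_
    · simp only [h i (by simp)]
    · simp [sum_pow_row hrow]
  · refine (hX.integral_le hmeas hnonneg hrow hT hki (Φ := fun y s => (P ^ b) s (y k))
      (fun y y' h => ?_) fun y s => pow_apply_nonneg hnonneg _ _ _).trans ?_
    · simp only [h k (by simp)]
    · simp [sum_pow_col hcol]

lemma sum_integral_pow_mul_pow_le_acoll (hmeas : ∀ n, Measurable (X n)) (i : ℕ) :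
    ∑ a ∈ range (T + 1), ∑ b ∈ range (T + 1),
        ∫ ω, ∑ s, (P ^ a) (X i ω) s * (P ^ b) (X i ω) s ∂μ ≤ Acoll P T := by
  have hdep {β : Type _} (g : S → β) : DependsOn (fun y : ℕ → S => g (y i)) (Set.Iic i) :=
    fun y y' h => by simp only [h i (by simp)]
  have hinteg (a b : ℕ) : Integrable
      (fun ω => ∑ s, (P ^ a) (X i ω) s * (P ^ b) (X i ω) s) μ :=
    integrable_comp_traj hmeas (hdep fun u => ∑ s, (P ^ a) u s * (P ^ b) u s)
  simp_rw [fun a => (integral_finsetSum (range (T + 1)) fun b _ => hinteg a b).symm]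
  rw [← integral_finsetSum _ fun a _ => integrable_finsetSum _ fun b _ => hinteg a b]
  simp_rw [sum_sum_pow_mul_pow_eq_greenFn_sq]
  exact integral_traj_le_const hmeas (hdep fun u => ∑ s, GreenFn P T u s ^ 2)
    fun y => sum_greenFn_sq_le_acoll P T (y i)

lemma sum_integral_pow_mul_pow_le_sqrt (hmeas : ∀ n, Measurable (X n)) (i : ℕ) :
    ∑ a ∈ range (T + 1), ∑ b ∈ range (T + 1),
        ∫ ω, ∑ s, (P ^ a) (X i ω) s * (P ^ b) s (X i ω) ∂μ
      ≤ Real.sqrt (Acoll P T * AcollStar P T) := by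
  have hdep {β : Type _} (g : S → β) : DependsOn (fun y : ℕ → S => g (y i)) (Set.Iic i) :=
    fun y y' h => by simp only [h i (by simp)]
  have hinteg (a b : ℕ) : Integrable
      (fun ω => ∑ s, (P ^ a) (X i ω) s * (P ^ b) s (X i ω)) μ :=
    integrable_comp_traj hmeas (hdep fun u => ∑ s, (P ^ a) u s * (P ^ b) s u)
  simp_rw [fun a => (integral_finsetSum (range (T + 1)) fun b _ => hinteg a b).symm]
  rw [← integral_finsetSum _ fun a _ => integrable_finsetSum _ fun b _ => hinteg a b]
  simp_rw [sum_sum_pow_mul_pow_eq_greenFn_mul]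
  exact integral_traj_le_const hmeas (hdep fun u => ∑ s, GreenFn P T u s * GreenFn P T s u)
    fun y => sum_greenFn_mul_le P T (y i)

lemma sum_forwardWeight_le (hmeas : ∀ n, Measurable (X n)) (hnonneg : ∀ u v, 0 ≤ P u v)
    (L : ℕ) :
    ∑ x ∈ timePairs T L, ∑ y ∈ timePairs T L, forwardWeight μ P X T x y
      ≤ (timePairs T L).card * Acoll P T := by
  unfold forwardWeight
  simp_rw [Finset.sum_comm (s := timePairs T L) (t := range (T + 1))]
  calc _ ≤ ∑ a ∈ range (T + 1), ∑ b ∈ range (T + 1), ∑ x ∈ timePairs T L,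
        ∫ ω, ∑ s, (P ^ a) (X x.1 ω) s * (P ^ b) (X x.1 ω) s ∂μ :=
        Finset.sum_le_sum fun a _ => Finset.sum_le_sum fun b _ =>
          sum_timePairs_shift_le T L a b
            (f := fun i => ∫ ω, ∑ s, (P ^ a) (X i ω) s * (P ^ b) (X i ω) s ∂μ)
            (integral_sum_pow_mul_pow_nonneg hnonneg a b)
    _ = ∑ x ∈ timePairs T L, ∑ a ∈ range (T + 1), ∑ b ∈ range (T + 1),
        ∫ ω, ∑ s, (P ^ a) (X x.1 ω) s * (P ^ b) (X x.1 ω) s ∂μ := by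
        simp_rw [Finset.sum_comm (s := timePairs T L) (t := range (T + 1))]
    _ ≤ ∑ x ∈ timePairs T L, Acoll P T :=
        Finset.sum_le_sum fun x _ => sum_integral_pow_mul_pow_le_acoll hmeas x.1
    _ = _ := by rw [Finset.sum_const, nsmul_eq_mul]

lemma sum_backwardWeight_le (hmeas : ∀ n, Measurable (X n)) (hnonneg : ∀ u v, 0 ≤ P u v)
    (L : ℕ) :
    ∑ x ∈ timePairs T L, ∑ y ∈ timePairs T L, backwardWeight μ P X T x y
      ≤ (timePairs T L).card * Real.sqrt (Acoll P T * AcollStar P T) := by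
  unfold backwardWeight
  simp_rw [Finset.sum_comm (s := timePairs T L) (t := range (T + 1))]
  calc _ ≤ ∑ a ∈ range (T + 1), ∑ b ∈ range (T + 1), ∑ x ∈ timePairs T L,
        ∫ ω, ∑ s, (P ^ a) (X x.1 ω) s * (P ^ b) s (X x.1 ω) ∂μ :=
        Finset.sum_le_sum fun a _ => Finset.sum_le_sum fun b _ =>
          sum_timePairs_swap_shift_le T L a b
            (f := fun i => ∫ ω, ∑ s, (P ^ a) (X i ω) s * (P ^ b) s (X i ω) ∂μ)
            (integral_sum_pow_mul_pow_nonneg' hnonneg a b)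
    _ = ∑ x ∈ timePairs T L, ∑ a ∈ range (T + 1), ∑ b ∈ range (T + 1),
        ∫ ω, ∑ s, (P ^ a) (X x.1 ω) s * (P ^ b) s (X x.1 ω) ∂μ := by
        simp_rw [Finset.sum_comm (s := timePairs T L) (t := range (T + 1))]
    _ ≤ ∑ x ∈ timePairs T L, Real.sqrt (Acoll P T * AcollStar P T) :=
        Finset.sum_le_sum fun x _ => sum_integral_pow_mul_pow_le_sqrt hmeas x.1
    _ = _ := by rw [Finset.sum_const, nsmul_eq_mul]

lemma IsMarkovTraj.integral_collision_mul_le_weight (hX : IsMarkovTraj μ P X)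
    (hmeas : ∀ n, Measurable (X n)) (hnonneg : ∀ u v, 0 ≤ P u v)
    (hrow : ∀ u, ∑ v, P u v = 1) (hcol : ∀ v, ∑ u, P u v = 1) (hT : ∀ u v, (P ^ T) u v ≤ c)
    (hc : 0 ≤ c) {x y : ℕ × ℕ} (hx : x.1 + 2 * T ≤ x.2) (hy : y.1 + 2 * T ≤ y.2)
    (hxy : x.2 ≤ y.2) :
    ∫ ω, (if X x.1 ω = X x.2 ω then (1 : ℝ) else 0) *
        (if X y.1 ω = X y.2 ω then 1 else 0) ∂μ
      ≤ c ^ 2 + c * (forwardWeight μ P X T x y + backwardWeight μ P X T x y) := by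
  have hF : 0 ≤ forwardWeight μ P X T x y := forwardWeight_nonneg hnonneg x y
  have hB : 0 ≤ backwardWeight μ P X T x y := backwardWeight_nonneg hnonneg x y
  rcases Nat.lt_or_ge y.2 (x.2 + T) with hlt | hge
  · refine (hX.integral_collision_mul_le hmeas hnonneg hrow hT (by lia) (by lia) hxy).trans ?_
    rw [sq, ← mul_add]
    refine mul_le_mul_of_nonneg_left ?_ hc
    by_cases hfar : x.1 + T ≤ y.1 ∨ y.1 + T ≤ x.1
    · linarith [hX.integral_pow_apply_le hmeas hnonneg hrow hcol hT hfar (y.2 - x.2)]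
    · rcases Nat.le_total x.1 y.1 with h | h
      · rw [hX.integral_pow_apply_eq_of_le hmeas h]
        linarith [le_forwardWeight (μ := μ) (X := X) (T := T) hnonneg (x := x) (y := y)
          (a := y.1 - x.1) (b := y.2 - x.2) (by lia) (by lia) (by lia) (by lia)]
      · rw [hX.integral_pow_apply_eq_of_ge hmeas h]
        linarith [le_backwardWeight (μ := μ) (X := X) (T := T) hnonneg (x := x) (y := y)
          (a := x.1 - y.1) (b := y.2 - x.2) (by lia) (by lia) (by lia) (by lia)]
  · have := hX.integral_collision_mul_le_sq hmeas hnonneg hrow hT hc (i := x.1) (k := y.1)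
      (by lia) (by lia) hge
    nlinarith [mul_nonneg hc (add_nonneg hF hB)]

end Collisions

theorem second_moment_self_intersections
    {S : Type*} [Fintype S] [DecidableEq S] [Nonempty S]
    [MeasurableSpace S] [MeasurableSingletonClass S]
    {Ω : Type*} [MeasurableSpace Ω] (μ : Measure Ω) [IsProbabilityMeasure μ]
    (P : Matrix S S ℝ)
    (hnonneg : ∀ u v, 0 ≤ P u v)
    (hrow : ∀ u, ∑ v, P u v = 1)
    (hcol : ∀ v, ∑ u, P u v = 1)
    (hergodic : ∃ n : ℕ, ∀ u v, 0 < (P ^ n) u v)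
    (N : ℕ) (hN : N = Fintype.card S)
    (T : ℕ) (m M : ℝ) (hm0 : 0 < m) (hm1 : m ≤ 1) (hM : 1 ≤ M)
    (hPT : ∀ u v, m / N ≤ (P ^ T) u v ∧ (P ^ T) u v ≤ M / N)
    (L : ℕ)
    (x0 : S) (X : ℕ → Ω → S)
    (hmeas : ∀ n, Measurable (X n))
    (hstart : μ {ω | X 0 ω = x0} = 1)
    (hmarkov : IsMarkovTraj μ P X) :
    ∫ ω, (collCount X T L ω) ^ 2 ∂μ
      ≤ (M / N) ^ 2 * (((L : ℝ) + 1) * ((L : ℝ) + 2) / 2) ^ 2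
        + 2 * (M / N) * (((L : ℝ) + 1) * ((L : ℝ) + 2) / 2) *
            (Acoll P T + Real.sqrt (Acoll P T * AcollStar P T)) := by

  set c : ℝ := M / N
  have hT : ∀ u v, (P ^ T) u v ≤ c := fun u v => (hPT u v).2
  have hc : 0 ≤ c := div_nonneg (by linarith) N.cast_nonneg
  set Z : ℝ := ((L : ℝ) + 1) * ((L : ℝ) + 2) / 2
  have hZ : ((timePairs T L).card : ℝ) = Z := card_timePairs T L
  let F := forwardWeight μ P X T
  let B := backwardWeight μ P X T
  have hF : ∀ x y, 0 ≤ F x y := forwardWeight_nonneg hnonneg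
  have hB : ∀ x y, 0 ≤ B x y := backwardWeight_nonneg hnonneg
  have hpair : ∀ x ∈ timePairs T L, ∀ y ∈ timePairs T L,
      ∫ ω, (if X x.1 ω = X x.2 ω then (1 : ℝ) else 0) *
          (if X y.1 ω = X y.2 ω then 1 else 0) ∂μ
        ≤ c ^ 2 + c * ((F x y + B x y) + (F y x + B y x)) := by
    intro x hx y hy
    have hx := (mem_timePairs.1 hx).1
    have hy := (mem_timePairs.1 hy).1
    rcases Nat.le_total x.2 y.2 with h | h
    · have := hmarkov.integral_collision_mul_le_weight hmeas hnonneg hrow hcol hT hc hx hy h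
      nlinarith [mul_nonneg hc (add_nonneg (hF y x) (hB y x))]
    · have := hmarkov.integral_collision_mul_le_weight hmeas hnonneg hrow hcol hT hc hy hx h
      simp_rw [mul_comm (ite (X y.1 _ = X y.2 _) (1 : ℝ) 0)] at this
      nlinarith [mul_nonneg hc (add_nonneg (hF x y) (hB x y))]
  have hsq : ∀ ω, collCount X T L ω ^ 2 = ∑ x ∈ timePairs T L, ∑ y ∈ timePairs T L,
      (if X x.1 ω = X x.2 ω then (1 : ℝ) else 0) * (if X y.1 ω = X y.2 ω then 1 else 0) := by
    intro ω
    rw [sq, ← Finset.sum_mul_sum, collCount,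
      ← sum_timePairs T L fun i j => if X i ω = X j ω then (1 : ℝ) else 0]
  have hinteg : ∀ x y : ℕ × ℕ, Integrable (fun ω => (if X x.1 ω = X x.2 ω then (1 : ℝ) else 0) *
      (if X y.1 ω = X y.2 ω then 1 else 0)) μ := fun x y =>
    integrable_comp_traj hmeas (n := x.1 + x.2 + y.1 + y.2)
      (φ := fun z => (if z x.1 = z x.2 then (1 : ℝ) else 0) * if z y.1 = z y.2 then 1 else 0)
      fun z z' h => by
        simp only [h x.1 (Set.mem_Iic.2 (by lia)), h x.2 (Set.mem_Iic.2 (by lia)),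
          h y.1 (Set.mem_Iic.2 (by lia)), h y.2 (Set.mem_Iic.2 (by lia))]
  have hFsum := sum_forwardWeight_le (μ := μ) (T := T) hmeas hnonneg L
  have hBsum := sum_backwardWeight_le (μ := μ) (T := T) hmeas hnonneg L
  rw [hZ] at hFsum hBsum
  simp_rw [hsq]
  rw [integral_finsetSum _ fun x _ => integrable_finsetSum _ fun y _ => hinteg x y]
  simp_rw [fun x => integral_finsetSum (timePairs T L) fun y _ => hinteg x y]
  calc _ ≤ ∑ x ∈ timePairs T L, ∑ y ∈ timePairs T L,
        (c ^ 2 + c * ((F x y + B x y) + (F y x + B y x))) :=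
        Finset.sum_le_sum fun x hx => Finset.sum_le_sum fun y hy => hpair x hx y hy
    _ = c ^ 2 * Z ^ 2 + 2 * c * (∑ x ∈ timePairs T L, ∑ y ∈ timePairs T L, F x y
          + ∑ x ∈ timePairs T L, ∑ y ∈ timePairs T L, B x y) := by
        simp_rw [Finset.sum_add_distrib, ← Finset.mul_sum, Finset.sum_add_distrib,
          Finset.sum_const, nsmul_eq_mul]
        rw [Finset.sum_comm (f := fun x y => F y x), Finset.sum_comm (f := fun x y => B y x), hZ]
        ring
    _ ≤ c ^ 2 * Z ^ 2 + 2 * c * (Z * Acoll P T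
          + Z * Real.sqrt (Acoll P T * AcollStar P T)) := by
        have h2c : 0 ≤ 2 * c := by linarith
        gcongr
    _ = _ := by ring
end

section
/- (Improved Birthday Paradox.) Let P be a doubly stochastic ergodic transition matrix on a finite state space of size N, and let T be an integer such that m/N ≤ P^T(u,v) ≤ M/N for all states u,v, where 0 < m ≤ 1 ≤ M. Then for any positive integer c and any starting state, a collision occurs within 2c·( √( (1 + ∑_{j=1}^{2T} 3j·max_{u,v} P^j(u,v))·(N/M) ) + T ) steps with probability at least 1 − (1 − m²/(2M²))^c. -/
open MeasureTheory Finset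

/-- The trajectory that starts at `x` and then follows `w`. -/
def trajCons {S : Type*} (x : S) (w : ℕ → S) : ℕ → S
  | 0 => x
  | i + 1 => w i

/-- The expectation of `f` over `n` steps of the chain with transition matrix `P` started at `x`;
the trajectory is frozen after `n` steps. -/
def trajExp {S : Type*} [Fintype S] (P : Matrix S S ℝ) : ℕ → S → ((ℕ → S) → ℝ) → ℝ
  | 0, x, f => f fun _ => x
  | n + 1, x, f => ∑ y, P x y * trajExp P n y fun w => f (trajCons x w)

section TrajExp

variable {S : Type*} [Fintype S] {P : Matrix S S ℝ}

lemma trajExp_congr {n : ℕ} {x : S} {f g : (ℕ → S) → ℝ} (h : ∀ w, w 0 = x → f w = g w) :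
    trajExp P n x f = trajExp P n x g := by
  cases n with
  | zero => exact h _ rfl
  | succ n =>
    have : (fun w => f (trajCons x w)) = fun w => g (trajCons x w) := funext fun w => h _ rfl
    simp only [trajExp, this]

lemma trajExp_mono (hP : ∀ u v, 0 ≤ P u v) {n : ℕ} {x : S} {f g : (ℕ → S) → ℝ}
    (h : ∀ w, f w ≤ g w) : trajExp P n x f ≤ trajExp P n x g := by
  induction n generalizing x f g with
  | zero => exact h _
  | succ n ih => exact sum_le_sum fun y _ => mul_le_mul_of_nonneg_left (ih fun w => h _) (hP x y)

lemma trajExp_mul_left (n : ℕ) (x : S) (a : ℝ) (f : (ℕ → S) → ℝ) :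
    trajExp P n x (fun w => a * f w) = a * trajExp P n x f := by
  induction n generalizing x f with
  | zero => rfl
  | succ n ih =>
    simp only [trajExp, ih, mul_sum]
    exact sum_congr rfl fun y _ => by ring

lemma trajExp_add (n : ℕ) (x : S) (f g : (ℕ → S) → ℝ) :
    trajExp P n x (fun w => f w + g w) = trajExp P n x f + trajExp P n x g := by
  induction n generalizing x f g with
  | zero => rfl
  | succ n ih => simp only [trajExp, ih, mul_add, sum_add_distrib]

lemma trajExp_zero (n : ℕ) (x : S) : trajExp P n x (fun _ => 0) = 0 := by
  simpa using trajExp_mul_left (P := P) n x 0 fun _ => 0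

lemma trajExp_sum {ι : Type*} (s : Finset ι) (n : ℕ) (x : S) (f : ι → (ℕ → S) → ℝ) :
    trajExp P n x (fun w => ∑ i ∈ s, f i w) = ∑ i ∈ s, trajExp P n x (f i) := by
  classical
  induction s using Finset.induction_on with
  | empty => simpa using trajExp_zero n x
  | insert i s hi ih => simp only [sum_insert hi, trajExp_add, ih]

/-- The Markov property. -/
lemma trajExp_mul_shift (a b : ℕ) (x : S) (f g : (ℕ → S) → ℝ)
    (hf : ∀ w w' : ℕ → S, (∀ i ≤ a, w i = w' i) → f w = f w') :
    trajExp P (a + b) x (fun w => f w * g fun i => w (a + i)) =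
      trajExp P a x fun w => f w * trajExp P b (w a) g := by
  induction a generalizing x f with
  | zero =>
    simp only [zero_add, trajExp, ← trajExp_mul_left]
    refine trajExp_congr fun w hw => ?_
    rw [hf w (fun _ => x) fun i hi => by rwa [Nat.le_zero.1 hi]]
  | succ a ih =>
    have h (w : ℕ → S) : (fun i => trajCons x w (a + 1 + i)) = fun i => w (a + i) := by
      funext i
      rw [Nat.add_right_comm]
      rfl
    rw [Nat.add_right_comm]
    simp only [trajExp, h]
    refine sum_congr rfl fun y _ => ?_
    rw [ih y (fun w => f (trajCons x w)) fun w w' hw => hf _ _ fun i hi => ?_]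
    · rfl
    · cases i with
      | zero => rfl
      | succ i => exact hw i (by omega)

variable [DecidableEq S]

lemma trajExp_const (hP : P ∈ Matrix.rowStochastic ℝ S) (n : ℕ) (x : S) (a : ℝ) :
    trajExp P n x (fun _ => a) = a := by
  induction n generalizing x with
  | zero => rfl
  | succ n ih => simp only [trajExp, ih, ← sum_mul, Matrix.sum_row_of_mem_rowStochastic hP, one_mul]

lemma trajExp_shift (a b : ℕ) (x : S) (g : (ℕ → S) → ℝ) :
    trajExp P (a + b) x (fun w => g fun i => w (a + i)) =
      ∑ y, (P ^ a) x y * trajExp P b y g := by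
  induction a generalizing x with
  | zero => simp [Matrix.one_apply]
  | succ a ih =>
    have h (w : ℕ → S) : (fun i => trajCons x w (a + 1 + i)) = fun i => w (a + i) := by
      funext i
      rw [Nat.add_right_comm]
      rfl
    rw [Nat.add_right_comm]
    simp only [trajExp, h, ih, pow_succ', Matrix.mul_apply, sum_mul, mul_sum]
    rw [sum_comm]
    simp only [mul_assoc]

lemma trajExp_two_point (a b c : ℕ) (hP : P ∈ Matrix.rowStochastic ℝ S) (x : S)
    (φ : S → S → ℝ) :
    trajExp P (a + (b + c)) x (fun w => φ (w a) (w (a + b))) =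
      ∑ u, (P ^ a) x u * ∑ v, (P ^ b) u v * φ u v := by
  refine (trajExp_shift a (b + c) x fun w => φ (w 0) (w b)).trans (sum_congr rfl fun u _ => ?_)
  congr 1
  rw [trajExp_congr (g := fun w => φ u (w b)) fun w hw => by rw [hw]]
  refine (trajExp_shift b c u fun w => φ u (w 0)).trans (sum_congr rfl fun v _ => ?_)
  congr 1
  rw [trajExp_congr (g := fun _ => φ u v) fun w hw => by rw [hw], trajExp_const hP]

lemma trajExp_four_point (a b c d e : ℕ) (hP : P ∈ Matrix.rowStochastic ℝ S) (x : S)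
    (φ : S → S → S → S → ℝ) :
    trajExp P (a + (b + (c + (d + e)))) x
        (fun w => φ (w a) (w (a + b)) (w (a + (b + c))) (w (a + (b + (c + d))))) =
      ∑ u, (P ^ a) x u * ∑ v, (P ^ b) u v * ∑ y, (P ^ c) v y * ∑ z, (P ^ d) y z * φ u v y z := by
  refine (trajExp_shift a _ x fun w => φ (w 0) (w b) (w (b + c)) (w (b + (c + d)))).trans
    (sum_congr rfl fun u _ => ?_)
  congr 1
  rw [trajExp_congr (g := fun w => φ u (w b) (w (b + c)) (w (b + (c + d)))) fun w hw => by rw [hw]]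
  refine (trajExp_shift b _ u fun w => φ u (w 0) (w c) (w (c + d))).trans
    (sum_congr rfl fun v _ => ?_)
  congr 1
  rw [trajExp_congr (g := fun w => φ u v (w c) (w (c + d))) fun w hw => by rw [hw]]
  exact trajExp_two_point c d e hP v (φ u v)

lemma trajExp_cylinder (n : ℕ) (x : S) (y : ℕ → S) :
    trajExp P n x (fun w => if ∀ i ≤ n, w i = y i then 1 else 0) =
      if y 0 = x then ∏ i ∈ range n, P (y i) (y (i + 1)) else 0 := by
  induction n generalizing x y with
  | zero => simp [trajExp, eq_comm]
  | succ n ih =>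
    have h (w : ℕ → S) : (∀ i ≤ n + 1, trajCons x w i = y i) ↔
        y 0 = x ∧ ∀ i ≤ n, w i = y (i + 1) := by
      refine ⟨fun h => ⟨(h 0 (by omega)).symm, fun i hi => h (i + 1) (by omega)⟩, ?_⟩
      rintro ⟨h0, h1⟩ (_ | i) hi
      · exact h0.symm
      · exact h1 i (by omega)
    simp only [trajExp, h]
    by_cases hx : y 0 = x
    · simp only [hx, true_and, ih _ fun i => y (i + 1), zero_add, if_true, mul_ite, mul_zero,
        sum_ite_eq, mem_univ, prod_range_succ', mul_comm]
    · simp [hx, trajExp_zero]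

lemma eq_sum_cylinder (n : ℕ) (f : (ℕ → S) → ℝ)
    (hf : ∀ w w' : ℕ → S, (∀ i ≤ n, w i = w' i) → f w = f w') (w : ℕ → S) :
    f w = ∑ p : Fin (n + 1) → S, f (fun i => p (Fin.ofNat (n + 1) i)) *
      if ∀ i ≤ n, w i = p (Fin.ofNat (n + 1) i) then 1 else 0 := by
  have hval (i : ℕ) (hi : i ≤ n) : ((Fin.ofNat (n + 1) i : Fin (n + 1)) : ℕ) = i :=
    Nat.mod_eq_of_lt (by omega)
  rw [sum_eq_single fun i : Fin (n + 1) => w i]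
  · rw [if_pos fun i hi => (congrArg w (hval i hi)).symm, mul_one]
    exact hf _ _ fun i hi => (congrArg w (hval i hi)).symm
  · intro p _ hp
    rw [if_neg, mul_zero]
    intro h
    refine hp (funext fun i => ?_)
    rw [h i (by omega)]
    congr 1
    exact Fin.ext (hval i (by omega)).symm
  · simp

end TrajExp
lemma IsMarkovTraj.measureReal_cylinder {S Ω : Type*} [DecidableEq S]
    [MeasurableSpace S] [MeasurableSingletonClass S] [MeasurableSpace Ω]
    {μ : Measure Ω} [IsProbabilityMeasure μ] {P : Matrix S S ℝ} {x : S} {X : ℕ → Ω → S}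
    (hX : IsMarkovTraj μ P X) (hmeas : Measurable (X 0)) (hstart : μ {ω | X 0 ω = x} = 1)
    (n : ℕ) (y : ℕ → S) :
    μ.real {ω | ∀ i ≤ n, X i ω = y i} =
      if y 0 = x then ∏ i ∈ range n, P (y i) (y (i + 1)) else 0 := by
  induction n with
  | zero =>
    split_ifs with h
    · simp [h, measureReal_def, hstart]
    · have h0 : μ {ω | X 0 ω = x}ᶜ = 0 :=
        (prob_compl_eq_zero_iff (hmeas (measurableSet_singleton x))).2 hstart
      have hsub : {ω | ∀ i ≤ 0, X i ω = y i} ⊆ {ω | X 0 ω = x}ᶜ :=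
        fun ω hω hx => h ((hω 0 le_rfl).symm.trans hx)
      rw [measureReal_def, measure_mono_null hsub h0, ENNReal.toReal_zero]
  | succ n ih =>
    rw [measureReal_def, hX n y, ← measureReal_def, ih, prod_range_succ]
    split_ifs
    · ring
    · simp

lemma IsMarkovTraj.integral_eq_trajExp {S Ω : Type*} [Fintype S] [DecidableEq S]
    [MeasurableSpace S] [MeasurableSingletonClass S] [MeasurableSpace Ω]
    {μ : Measure Ω} [IsProbabilityMeasure μ] {P : Matrix S S ℝ} {x : S} {X : ℕ → Ω → S}
    (hX : IsMarkovTraj μ P X) (hmeas : ∀ n, Measurable (X n)) (hstart : μ {ω | X 0 ω = x} = 1)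
    (n : ℕ) (f : (ℕ → S) → ℝ)
    (hf : ∀ w w' : ℕ → S, (∀ i ≤ n, w i = w' i) → f w = f w') :
    ∫ ω, f (fun i => X i ω) ∂μ = trajExp P n x f := by
  have hset (y : ℕ → S) : MeasurableSet {ω | ∀ i ≤ n, X i ω = y i} := by
    simp only [Set.ofPred_forall]
    exact .iInter fun i => .iInter fun _ => hmeas i (measurableSet_singleton (y i))
  have hind (y : ℕ → S) : (fun ω => if ∀ i ≤ n, X i ω = y i then (1 : ℝ) else 0) =
      {ω | ∀ i ≤ n, X i ω = y i}.indicator 1 := by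
    funext ω
    simp [Set.indicator_apply]
  rw [funext (eq_sum_cylinder n f hf), trajExp_sum]
  rw [integral_finsetSum]
  · refine sum_congr rfl fun p _ => ?_
    rw [integral_const_mul, trajExp_mul_left, trajExp_cylinder n x fun i => p (Fin.ofNat (n + 1) i),
      hind fun i => p (Fin.ofNat (n + 1) i), integral_indicator_one (hset _),
      hX.measureReal_cylinder (hmeas 0) hstart n fun i => p (Fin.ofNat (n + 1) i)]
  · intro p _
    refine Integrable.const_mul ?_ _
    rw [hind fun i => p (Fin.ofNat (n + 1) i)]
    exact (integrable_const 1).indicator (hset _)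

section RowStochastic

variable {S : Type*} [Fintype S] [DecidableEq S] {P : Matrix S S ℝ}

lemma rowStochastic_sum_mul_le (hP : P ∈ Matrix.rowStochastic ℝ S) {r : ℝ} (u : S) {g : S → ℝ}
    (hg : ∀ v, g v ≤ r) : ∑ v, P u v * g v ≤ r := by
  calc ∑ v, P u v * g v ≤ ∑ v, P u v * r :=
        sum_le_sum fun v _ =>
          mul_le_mul_of_nonneg_left (hg v) (Matrix.nonneg_of_mem_rowStochastic hP)
    _ = r := by rw [← sum_mul, Matrix.sum_row_of_mem_rowStochastic hP, one_mul]

lemma le_rowStochastic_sum_mul (hP : P ∈ Matrix.rowStochastic ℝ S) {r : ℝ} (u : S) {g : S → ℝ}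
    (hg : ∀ v, r ≤ g v) : r ≤ ∑ v, P u v * g v := by
  have := rowStochastic_sum_mul_le hP u (g := fun v => -g v) (r := -r) fun v => neg_le_neg (hg v)
  simp only [mul_neg, sum_neg_distrib] at this
  exact neg_le_neg_iff.1 this

lemma rowStochastic_pow_le (hP : P ∈ Matrix.rowStochastic ℝ S) {r : ℝ} {T s : ℕ}
    (h : ∀ u v, (P ^ T) u v ≤ r) (hs : T ≤ s) (u v : S) : (P ^ s) u v ≤ r := by
  rw [← Nat.sub_add_cancel hs, pow_add, Matrix.mul_apply]
  exact rowStochastic_sum_mul_le (pow_mem hP _) u fun w => h w v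

lemma le_rowStochastic_pow (hP : P ∈ Matrix.rowStochastic ℝ S) {r : ℝ} {T s : ℕ}
    (h : ∀ u v, r ≤ (P ^ T) u v) (hs : T ≤ s) (u v : S) : r ≤ (P ^ s) u v := by
  rw [← Nat.sub_add_cancel hs, pow_add, Matrix.mul_apply]
  exact le_rowStochastic_sum_mul (pow_mem hP _) u fun w => h w v

end RowStochastic

section HexNorm

/-- The norm on `ℤ²` whose sphere of radius `s` is a hexagon with `6 * s` lattice points. -/
def hexNorm (a b : ℤ) : ℕ := max (max a.natAbs b.natAbs) (a - b).natAbs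

lemma card_hexNorm_eq_le (A : Finset (ℤ × ℤ)) {s : ℕ} (hs : 0 < s) :
    #{z ∈ A | hexNorm z.1 z.2 = s} ≤ 6 * s := by
  have hsub : {z ∈ A | hexNorm z.1 z.2 = s} ⊆
      (range s).image (fun t : ℕ => ((s : ℤ), (t : ℤ))) ∪
      (range s).image (fun t : ℕ => ((s : ℤ) - t, (s : ℤ))) ∪
      (range s).image (fun t : ℕ => (-(t : ℤ), (s : ℤ) - t)) ∪
      (range s).image (fun t : ℕ => (-(s : ℤ), -(t : ℤ))) ∪
      (range s).image (fun t : ℕ => (-(s : ℤ) + t, -(s : ℤ))) ∪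
      (range s).image (fun t : ℕ => ((t : ℤ), -(s : ℤ) + t)) := by
    rintro ⟨a, b⟩ h
    have h := (mem_filter.1 h).2
    simp only [hexNorm] at h
    simp only [mem_union, mem_image, mem_range, Prod.mk.injEq]
    have key : (a = s ∧ 0 ≤ b ∧ b < s) ∨ (b = s ∧ 0 < a ∧ a ≤ s) ∨
        (b - a = s ∧ -s < a ∧ a ≤ 0) ∨ (a = -s ∧ -s < b ∧ b ≤ 0) ∨
        (b = -s ∧ -s ≤ a ∧ a < 0) ∨ (a - b = s ∧ 0 ≤ a ∧ a < s) := by omega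
    rcases key with h | h | h | h | h | h
    · exact .inl <| .inl <| .inl <| .inl <| .inl ⟨b.toNat, by omega⟩
    · exact .inl <| .inl <| .inl <| .inl <| .inr ⟨(s - a).toNat, by omega⟩
    · exact .inl <| .inl <| .inl <| .inr ⟨(-a).toNat, by omega⟩
    · exact .inl <| .inl <| .inr ⟨(-b).toNat, by omega⟩
    · exact .inl <| .inr ⟨(a + s).toNat, by omega⟩
    · exact .inr ⟨a.toNat, by omega⟩
  refine (card_le_card hsub).trans ?_
  have hc (f : ℕ → ℤ × ℤ) : #((range s).image f) ≤ s := card_image_le.trans (card_range s).le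
  have : 6 * s = s + s + s + s + s + s := by ring
  rw [this]
  iterate 5
    refine (card_union_le _ _).trans (add_le_add ?_ (hc _))
  exact hc _

lemma card_hexNorm_eq_zero_le (A : Finset (ℤ × ℤ)) : #{z ∈ A | hexNorm z.1 z.2 = 0} ≤ 1 := by
  refine card_le_one.2 fun z hz w hw => ?_
  have hz := (mem_filter.1 hz).2
  have hw := (mem_filter.1 hw).2
  simp only [hexNorm] at hz hw
  ext <;> omega

lemma sum_hexNorm_le (T : ℕ) (p : ℕ → ℝ) (hp : ∀ s, 0 ≤ p s) :
    ∑ z ∈ Ioo (-T : ℤ) T ×ˢ Ioo (-T : ℤ) T, p (hexNorm z.1 z.2) ≤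
      p 0 + ∑ s ∈ Icc 1 (2 * T), 6 * (s : ℝ) * p s := by
  set A := Ioo (-T : ℤ) T ×ˢ Ioo (-T : ℤ) T
  have hmaps : ∀ z ∈ A, hexNorm z.1 z.2 ∈ insert 0 (Icc 1 (2 * T)) := by
    intro z hz
    simp only [A, mem_product, mem_Ioo] at hz
    simp only [hexNorm, mem_insert, mem_Icc]
    omega
  rw [← sum_fiberwise_of_maps_to hmaps, sum_insert (by simp)]
  have hfiber (s : ℕ) : ∑ z ∈ A with hexNorm z.1 z.2 = s, p (hexNorm z.1 z.2) =
      #{z ∈ A | hexNorm z.1 z.2 = s} * p s := by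
    rw [sum_congr rfl fun z hz => by rw [(mem_filter.1 hz).2], sum_const, nsmul_eq_mul]
  simp only [hfiber]
  refine add_le_add ?_ (sum_le_sum fun s hs => ?_)
  · exact mul_le_of_le_one_left (hp 0) (mod_cast card_hexNorm_eq_zero_le A)
  · exact mul_le_mul_of_nonneg_right (mod_cast card_hexNorm_eq_le A (mem_Icc.1 hs).1) (hp s)

end HexNorm

section PairBound

/-- A bound for the probability that `X i = X j` and `X k = X l`, in terms of `a = k - i` and
`b = l - j`, when `r` bounds the transition probabilities in at least `T` steps and `p s` those
in `s` steps. -/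
def pairBound (r : ℝ) (p : ℕ → ℝ) (T : ℕ) (a b : ℤ) : ℝ :=
  r * r + if |a| < T ∧ |b| < T then r * p (hexNorm a b) else 0

lemma pairBound_neg (r : ℝ) (p : ℕ → ℝ) (T : ℕ) (a b : ℤ) :
    pairBound r p T (-a) (-b) = pairBound r p T a b := by
  have h : hexNorm (-a) (-b) = hexNorm a b := by
    simp only [hexNorm]
    omega
  simp only [pairBound, h, abs_neg]

lemma mul_self_le_pairBound {r : ℝ} {p : ℕ → ℝ} (hr : 0 ≤ r) (hp : ∀ s, 0 ≤ p s) (T : ℕ)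
    (a b : ℤ) : r * r ≤ pairBound r p T a b := by
  have := mul_nonneg hr (hp (hexNorm a b))
  unfold pairBound
  split_ifs <;> linarith

lemma mul_le_pairBound {r : ℝ} {p : ℕ → ℝ} {T : ℕ} {a b : ℤ}
    (ha : |a| < T) (hb : |b| < T) {s : ℕ} (hs : hexNorm a b = s) :
    r * p s ≤ pairBound r p T a b := by
  rw [pairBound, if_pos ⟨ha, hb⟩, hs]
  exact le_add_of_nonneg_left (mul_self_nonneg r)

variable {S : Type*} [Fintype S] [DecidableEq S] {P : Matrix S S ℝ} {T : ℕ} {r : ℝ} {p : ℕ → ℝ}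

lemma trajExp_pair_crossing_le (hP : P ∈ Matrix.rowStochastic ℝ S) (hr : 0 ≤ r)
    (hPr : ∀ u v, (P ^ T) u v ≤ r) (hp : ∀ s, 0 ≤ p s) (hPp : ∀ s u v, (P ^ s) u v ≤ p s)
    {i j k l L : ℕ} (hik : i ≤ k) (hkj : k ≤ j) (hjl : j ≤ l) (hl : l ≤ L)
    (hij : i + 2 * T ≤ j) (hkl : k + 2 * T ≤ l) (x : S) :
    trajExp P L x (fun w => if w i = w j ∧ w k = w l then 1 else 0) ≤
      pairBound r p T (k - i) (l - j) := by
  obtain ⟨b, rfl⟩ := Nat.exists_eq_add_of_le hik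
  obtain ⟨c, rfl⟩ := Nat.exists_eq_add_of_le hkj
  obtain ⟨d, rfl⟩ := Nat.exists_eq_add_of_le hjl
  obtain ⟨e, rfl⟩ := Nat.exists_eq_add_of_le hl
  simp only [add_assoc]
  rw [trajExp_four_point i b c d e hP x fun u v y z => if u = y ∧ v = z then 1 else 0]
  refine rowStochastic_sum_mul_le (pow_mem hP _) x fun u => ?_
  have hterm (v : S) : ∑ y, (P ^ c) v y * ∑ z, (P ^ d) y z *
      (if u = y ∧ v = z then (1 : ℝ) else 0) = (P ^ c) v u * (P ^ d) u v := by
    simp [ite_and]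
  have hnn (s : ℕ) (u v : S) : 0 ≤ (P ^ s) u v :=
    Matrix.nonneg_of_mem_rowStochastic (pow_mem hP s)
  have hle (s : ℕ) (hs : T ≤ s) (u v : S) : (P ^ s) u v ≤ r := rowStochastic_pow_le hP hPr hs u v
  simp only [hterm]
  rcases le_or_gt T b with hb | hb
  · refine le_trans ?_ (mul_self_le_pairBound hr hp ..)
    calc _ ≤ ∑ v, r * ((P ^ d) u v * (P ^ c) v u) := sum_le_sum fun v _ => by
          rw [mul_comm ((P ^ d) u v)]
          exact mul_le_mul_of_nonneg_right (hle b hb u v) (mul_nonneg (hnn ..) (hnn ..))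
      _ = r * (P ^ (d + c)) u u := by rw [← mul_sum, pow_add, Matrix.mul_apply]
      _ ≤ r * r := mul_le_mul_of_nonneg_left (hle _ (by omega) u u) hr
  rcases le_or_gt T d with hd | hd
  · refine le_trans ?_ (mul_self_le_pairBound hr hp ..)
    calc _ ≤ ∑ v, r * ((P ^ b) u v * (P ^ c) v u) := sum_le_sum fun v _ => by
          rw [← mul_assoc, mul_comm]
          exact mul_le_mul_of_nonneg_right (hle d hd u v) (mul_nonneg (hnn ..) (hnn ..))
      _ = r * (P ^ (b + c)) u u := by rw [← mul_sum, pow_add, Matrix.mul_apply]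
      _ ≤ r * r := mul_le_mul_of_nonneg_left (hle _ (by omega) u u) hr
  have hc : T ≤ c := by omega
  refine le_trans ?_ (mul_le_pairBound (s := max b d) (abs_lt.2 (by omega)) (abs_lt.2 (by omega))
    (by simp only [hexNorm]; omega))
  rcases le_total b d with hbd | hbd
  · rw [max_eq_right hbd]
    exact rowStochastic_sum_mul_le (pow_mem hP b) u fun v =>
      mul_le_mul (hle c hc v u) (hPp d u v) (hnn ..) hr
  · rw [max_eq_left hbd]
    refine (rowStochastic_sum_mul_le (g := fun v => (P ^ c) v u * (P ^ b) u v)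
      (pow_mem hP d) u fun v =>
      mul_le_mul (hle c hc v u) (hPp b u v) (hnn ..) hr).trans' (le_of_eq ?_)
    exact sum_congr rfl fun v _ => by ring

lemma trajExp_pair_nested_le (hP : P ∈ Matrix.rowStochastic ℝ S) (hr : 0 ≤ r)
    (hPr : ∀ u v, (P ^ T) u v ≤ r) (hp : ∀ s, 0 ≤ p s) (hPp : ∀ s u v, (P ^ s) u v ≤ p s)
    {i j k l L : ℕ} (hik : i ≤ k) (hlj : l ≤ j) (hj : j ≤ L) (hkl : k + 2 * T ≤ l) (x : S) :
    trajExp P L x (fun w => if w i = w j ∧ w k = w l then 1 else 0) ≤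
      pairBound r p T (k - i) (l - j) := by
  obtain ⟨b, rfl⟩ := Nat.exists_eq_add_of_le hik
  obtain ⟨c, rfl⟩ := Nat.exists_eq_add_of_le (show i + b ≤ l by omega)
  obtain ⟨d, rfl⟩ := Nat.exists_eq_add_of_le hlj
  obtain ⟨e, rfl⟩ := Nat.exists_eq_add_of_le hj
  simp only [add_assoc]
  rw [trajExp_four_point i b c d e hP x fun u v y z => if u = z ∧ v = y then 1 else 0]
  refine rowStochastic_sum_mul_le (pow_mem hP _) x fun u => ?_
  have hterm (v : S) : ∑ y, (P ^ c) v y * ∑ z, (P ^ d) y z *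
      (if u = z ∧ v = y then (1 : ℝ) else 0) = (P ^ c) v v * (P ^ d) v u := by
    simp [ite_and]
  have hnn (s : ℕ) (u v : S) : 0 ≤ (P ^ s) u v :=
    Matrix.nonneg_of_mem_rowStochastic (pow_mem hP s)
  have hle (s : ℕ) (hs : T ≤ s) (u v : S) : (P ^ s) u v ≤ r := rowStochastic_pow_le hP hPr hs u v
  simp only [hterm]
  calc _ ≤ ∑ v, r * ((P ^ b) u v * (P ^ d) v u) := sum_le_sum fun v _ => by
        rw [mul_left_comm]
        exact mul_le_mul_of_nonneg_right (hle c (by omega) v v) (mul_nonneg (hnn ..) (hnn ..))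
    _ = r * (P ^ (b + d)) u u := by rw [← mul_sum, pow_add, Matrix.mul_apply]
    _ ≤ _ := ?_
  by_cases hbd : b < T ∧ d < T
  · exact (mul_le_mul_of_nonneg_left (hPp _ u u) hr).trans
      (mul_le_pairBound (abs_lt.2 (by omega)) (abs_lt.2 (by omega))
        (by simp only [hexNorm]; omega))
  · exact (mul_le_mul_of_nonneg_left (hle _ (by omega) u u) hr).trans
      (mul_self_le_pairBound hr hp ..)

lemma trajExp_pair_disjoint_le (hP : P ∈ Matrix.rowStochastic ℝ S) (hr : 0 ≤ r)
    (hPr : ∀ u v, (P ^ T) u v ≤ r)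
    {i j k l L : ℕ} (hjk : j ≤ k) (hl : l ≤ L) (hij : i + 2 * T ≤ j) (hkl : k + 2 * T ≤ l) (x : S) :
    trajExp P L x (fun w => if w i = w j ∧ w k = w l then 1 else 0) ≤ r * r := by
  obtain ⟨b, rfl⟩ := Nat.exists_eq_add_of_le (show i ≤ j by omega)
  obtain ⟨c, rfl⟩ := Nat.exists_eq_add_of_le hjk
  obtain ⟨d, rfl⟩ := Nat.exists_eq_add_of_le (show i + b + c ≤ l by omega)
  obtain ⟨e, rfl⟩ := Nat.exists_eq_add_of_le hl
  simp only [add_assoc]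
  rw [trajExp_four_point i b c d e hP x fun u v y z => if u = v ∧ y = z then 1 else 0]
  refine rowStochastic_sum_mul_le (pow_mem hP _) x fun u => ?_
  have hle (s : ℕ) (hs : T ≤ s) (u v : S) : (P ^ s) u v ≤ r := rowStochastic_pow_le hP hPr hs u v
  have hterm : ∑ v, (P ^ b) u v * ∑ y, (P ^ c) v y * ∑ z, (P ^ d) y z *
      (if u = v ∧ y = z then (1 : ℝ) else 0) = (P ^ b) u u * ∑ y, (P ^ c) u y * (P ^ d) y y := by
    simp [ite_and]
  rw [hterm]
  exact mul_le_mul (hle b (by omega) u u)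
    (rowStochastic_sum_mul_le (pow_mem hP c) u fun y => hle d (by omega) y y)
    (sum_nonneg fun y _ => mul_nonneg (Matrix.nonneg_of_mem_rowStochastic (pow_mem hP c))
      (Matrix.nonneg_of_mem_rowStochastic (pow_mem hP d))) hr

lemma trajExp_pair_le (hP : P ∈ Matrix.rowStochastic ℝ S) (hr : 0 ≤ r)
    (hPr : ∀ u v, (P ^ T) u v ≤ r) (hp : ∀ s, 0 ≤ p s) (hPp : ∀ s u v, (P ^ s) u v ≤ p s)
    {i j k l L : ℕ} (hj : j ≤ L) (hl : l ≤ L) (hij : i + 2 * T ≤ j) (hkl : k + 2 * T ≤ l) (x : S) :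
    trajExp P L x (fun w => if w i = w j ∧ w k = w l then 1 else 0) ≤
      pairBound r p T (k - i) (l - j) := by
  wlog hik : i ≤ k generalizing i j k l
  · have := this hl hj hkl hij (le_of_not_ge hik)
    rw [← pairBound_neg, neg_sub, neg_sub] at this
    simpa only [and_comm] using this
  rcases le_total j k with hjk | hkj
  · exact (trajExp_pair_disjoint_le hP hr hPr hjk hl hij hkl x).trans
      (mul_self_le_pairBound hr hp ..)
  rcases le_total j l with hjl | hlj
  · exact trajExp_pair_crossing_le hP hr hPr hp hPp hik hkj hjl hl hij hkl x
  · exact trajExp_pair_nested_le hP hr hPr hp hPp hik hlj hj hkl x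

end PairBound

section SecondMoment

/-- The indicator of the event that the first `n + 1` states are distinct. -/
noncomputable def noCollision {S : Type*} (n : ℕ) (w : ℕ → S) : ℝ :=
  open Classical in if ∃ i j, i < j ∧ j ≤ n ∧ w i = w j then 0 else 1

lemma noCollision_nonneg {S : Type*} (n : ℕ) (w : ℕ → S) : 0 ≤ noCollision n w := by
  unfold noCollision
  split_ifs <;> norm_num

lemma noCollision_congr {S : Type*} {n : ℕ} {w w' : ℕ → S} (h : ∀ i ≤ n, w i = w' i) :
    noCollision n w = noCollision n w' := by
  have : (∃ i j, i < j ∧ j ≤ n ∧ w i = w j) ↔ ∃ i j, i < j ∧ j ≤ n ∧ w' i = w' j := by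
    refine exists₂_congr fun i j => and_congr_right fun hij => and_congr_right fun hj => ?_
    rw [h i (by omega), h j hj]
  classical exact if_congr this rfl rfl

lemma noCollision_add_le {S : Type*} (a b : ℕ) (w : ℕ → S) :
    noCollision (a + b) w ≤ noCollision a w * noCollision b fun i => w (a + i) := by
  unfold noCollision
  split_ifs with h h1 h2 h2 h1 h2 h2 <;> norm_num
  · obtain ⟨i, j, hij, hj, hw⟩ := h1
    exact h ⟨i, j, hij, by omega, hw⟩
  · obtain ⟨i, j, hij, hj, hw⟩ := h1
    exact h ⟨i, j, hij, by omega, hw⟩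
  · obtain ⟨i, j, hij, hj, hw⟩ := h2
    exact h ⟨a + i, a + j, by omega, by omega, hw⟩

/-- The pairs `i ≤ j < n`. -/
def orderedPairs (n : ℕ) : Finset (ℕ × ℕ) := {z ∈ range n ×ˢ range n | z.1 ≤ z.2}

lemma sq_le_two_mul_card_orderedPairs (n : ℕ) : n ^ 2 ≤ 2 * #(orderedPairs n) := by
  have hsub : range n ×ˢ range n ⊆ orderedPairs n ∪ (orderedPairs n).image Prod.swap := by
    rintro ⟨i, j⟩ h
    simp only [orderedPairs, mem_union, mem_image, mem_filter, mem_product, mem_range,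
      Prod.exists, Prod.swap_prod_mk, Prod.mk.injEq] at h ⊢
    rcases le_total i j with hij | hij
    · exact .inl ⟨h, hij⟩
    · exact .inr ⟨j, i, ⟨h.symm, hij⟩, rfl, rfl⟩
  have h1 := (card_le_card hsub).trans (card_union_le _ _)
  have h2 : #((orderedPairs n).image Prod.swap) ≤ #(orderedPairs n) := card_image_le
  rw [card_product, card_range] at h1
  nlinarith

/-- The number of collisions `X i = X (j + 2 * T)` with `i ≤ j < n`. -/
def collisionCount {S : Type*} [DecidableEq S] (T n : ℕ) (w : ℕ → S) : ℝ :=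
  ∑ z ∈ orderedPairs n, if w z.1 = w (z.2 + 2 * T) then 1 else 0

lemma noCollision_le_sq {S : Type*} [DecidableEq S] {T : ℕ} (hT : 0 < T) (K : ℕ) (τ : ℝ) (w : ℕ → S) :
    noCollision (2 * T + K) w ≤ (1 - τ * collisionCount T (K + 1) w) ^ 2 := by
  unfold noCollision
  split_ifs with h
  · exact sq_nonneg _
  · have : collisionCount T (K + 1) w = 0 := by
      refine sum_eq_zero fun z hz => if_neg fun hw => h ⟨z.1, z.2 + 2 * T, ?_, ?_, hw⟩
      all_goals
        simp only [orderedPairs, mem_filter, mem_product, mem_range] at hz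
        omega
    simp [this]

variable {S : Type*} [Fintype S] [DecidableEq S] {P : Matrix S S ℝ}

lemma trajExp_noCollision_pow_le (hP : P ∈ Matrix.rowStochastic ℝ S) {L : ℕ} {θ : ℝ}
    (h : ∀ x, trajExp P L x (noCollision L) ≤ θ) (c : ℕ) (x : S) :
    trajExp P (c * L) x (noCollision (c * L)) ≤ θ ^ c := by
  have hnn : ∀ u v, 0 ≤ P u v := fun u v => Matrix.nonneg_of_mem_rowStochastic hP
  have hθ : 0 ≤ θ := (h x).trans' <| by
    rw [← trajExp_zero (P := P) L x]
    exact trajExp_mono hnn (noCollision_nonneg L)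
  induction c generalizing x with
  | zero =>
    rw [pow_zero, ← trajExp_const hP (0 * L) x 1]
    refine trajExp_mono hnn fun w => ?_
    unfold noCollision
    split_ifs <;> norm_num
  | succ c ih =>
    rw [Nat.succ_mul, add_comm (c * L)]
    calc _ ≤ _ := trajExp_mono hnn (noCollision_add_le L (c * L))
      _ = _ := trajExp_mul_shift L (c * L) x (noCollision L) (noCollision (c * L))
        fun w w' => noCollision_congr
      _ ≤ trajExp P L x fun w => θ ^ c * noCollision L w := trajExp_mono hnn fun w => by
        rw [mul_comm]
        exact mul_le_mul_of_nonneg_right (ih _) (noCollision_nonneg L w)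
      _ = θ ^ c * trajExp P L x (noCollision L) := trajExp_mul_left ..
      _ ≤ θ ^ (c + 1) := mul_le_mul_of_nonneg_left (h x) (pow_nonneg hθ c)

lemma le_trajExp_collisionCount (hP : P ∈ Matrix.rowStochastic ℝ S) {T : ℕ} {q : ℝ}
    (hq : ∀ u v, q ≤ (P ^ T) u v) (K : ℕ) (x : S) :
    #(orderedPairs (K + 1)) * q ≤ trajExp P (2 * T + K) x (collisionCount T (K + 1)) := by
  unfold collisionCount
  rw [trajExp_sum, ← nsmul_eq_mul]
  refine card_nsmul_le_sum _ _ _ fun z hz => ?_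
  simp only [orderedPairs, mem_filter, mem_product, mem_range] at hz
  obtain ⟨d, hd⟩ := Nat.exists_eq_add_of_le (show z.1 ≤ z.2 + 2 * T by omega)
  obtain ⟨e, he⟩ := Nat.exists_eq_add_of_le (show z.1 + d ≤ 2 * T + K by omega)
  rw [hd, he, add_assoc, trajExp_two_point z.1 d e hP x fun u v => if u = v then 1 else 0]
  refine le_rowStochastic_sum_mul (pow_mem hP _) x fun u => ?_
  simpa using le_rowStochastic_pow hP hq (show T ≤ d by omega) u u

variable {T : ℕ} {r : ℝ} {p : ℕ → ℝ}

lemma sum_pairBound_le (hr : 0 ≤ r) (hp : ∀ s, 0 ≤ p s) (A : Finset (ℕ × ℕ)) (z : ℕ × ℕ) :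
    ∑ y ∈ A, pairBound r p T (y.1 - z.1) (y.2 - z.2) ≤
      #A * (r * r) + r * ∑ y ∈ Ioo (-T : ℤ) T ×ˢ Ioo (-T : ℤ) T, p (hexNorm y.1 y.2) := by
  unfold pairBound
  rw [sum_add_distrib, sum_const, nsmul_eq_mul, ← sum_filter, mul_sum]
  refine add_le_add le_rfl ?_
  set g : ℕ × ℕ → ℤ × ℤ := fun y => (y.1 - z.1, y.2 - z.2)
  have hg : Function.Injective g := by
    intro y y' h
    simp only [g, Prod.mk.injEq] at h
    ext <;> omega
  rw [← sum_image (g := g) (f := fun y : ℤ × ℤ => r * p (hexNorm y.1 y.2)) hg.injOn]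
  refine sum_le_sum_of_subset_of_nonneg (fun y hy => ?_) fun y _ _ => mul_nonneg hr (hp _)
  obtain ⟨y, hyA, rfl⟩ := mem_image.1 hy
  have hyT := (mem_filter.1 hyA).2
  rw [abs_lt, abs_lt] at hyT
  simpa only [mem_product, mem_Ioo] using hyT

lemma trajExp_collisionCount_sq_le (hP : P ∈ Matrix.rowStochastic ℝ S) (hr : 0 ≤ r)
    (hPr : ∀ u v, (P ^ T) u v ≤ r) (hp : ∀ s, 0 ≤ p s) (hPp : ∀ s u v, (P ^ s) u v ≤ p s)
    (K : ℕ) (x : S) :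
    trajExp P (2 * T + K) x (fun w => collisionCount T (K + 1) w ^ 2) ≤
      #(orderedPairs (K + 1)) * (#(orderedPairs (K + 1)) * (r * r) +
        r * ∑ y ∈ Ioo (-T : ℤ) T ×ˢ Ioo (-T : ℤ) T, p (hexNorm y.1 y.2)) := by
  simp only [collisionCount, sq, sum_mul_sum, ite_zero_mul_ite_zero, mul_one]
  rw [trajExp_sum, ← nsmul_eq_mul]
  refine sum_le_card_nsmul _ _ _ fun z hz => ?_
  rw [trajExp_sum]
  refine (sum_le_sum fun y hy => ?_).trans (sum_pairBound_le (T := T) hr hp _ z)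
  simp only [orderedPairs, mem_filter, mem_product, mem_range] at hz hy
  refine (trajExp_pair_le hP hr hPr hp hPp (by omega) (by omega) (by omega) (by omega) x).trans
    (le_of_eq ?_)
  push_cast
  rw [add_sub_add_right_eq_sub]

/-- The second moment method for a single block of steps. -/
lemma trajExp_noCollision_le (hP : P ∈ Matrix.rowStochastic ℝ S) (hT : 0 < T) {q : ℝ} (hr : 0 < r)
    (hPq : ∀ u v, q ≤ (P ^ T) u v) (hq : 0 ≤ q) (hPr : ∀ u v, (P ^ T) u v ≤ r)
    (hp : ∀ s, 0 ≤ p s) (hPp : ∀ s u v, (P ^ s) u v ≤ p s) (K : ℕ)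
    (hK : p 0 + ∑ s ∈ Icc 1 (2 * T), 6 * (s : ℝ) * p s ≤ r * #(orderedPairs (K + 1))) (x : S) :
    trajExp P (2 * T + K) x (noCollision (2 * T + K)) ≤ 1 - q ^ 2 / (2 * r ^ 2) := by
  have hC : (0 : ℝ) < #(orderedPairs (K + 1)) := by
    have := sq_le_two_mul_card_orderedPairs (K + 1)
    have : 0 < (K + 1) ^ 2 := by positivity
    exact_mod_cast (by omega : 0 < #(orderedPairs (K + 1)))
  have h1 := le_trajExp_collisionCount hP hPq K x
  have h2 := trajExp_collisionCount_sq_le hP hr.le hPr hp hPp K x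
  have hH := (sum_hexNorm_le T p hp).trans hK
  set C : ℝ := (#(orderedPairs (K + 1)) : ℝ)
  have h2' : trajExp P (2 * T + K) x (fun w => collisionCount T (K + 1) w ^ 2) ≤
      2 * (C * r) ^ 2 := h2.trans <| by
    have := mul_le_mul_of_nonneg_left hH (mul_nonneg hC.le hr.le)
    linarith
  set τ := q / (2 * C * r ^ 2)
  have hτ : 0 ≤ τ := by positivity
  calc _ ≤ _ := trajExp_mono (fun u v => Matrix.nonneg_of_mem_rowStochastic hP)
        (noCollision_le_sq hT K τ)
    _ = trajExp P (2 * T + K) x (fun w => 1 + (-(2 * τ) * collisionCount T (K + 1) w +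
          τ ^ 2 * collisionCount T (K + 1) w ^ 2)) := trajExp_congr fun w _ => by ring
    _ = 1 + (-(2 * τ) * trajExp P (2 * T + K) x (collisionCount T (K + 1)) +
          τ ^ 2 * trajExp P (2 * T + K) x (fun w => collisionCount T (K + 1) w ^ 2)) := by
      rw [trajExp_add, trajExp_add, trajExp_mul_left, trajExp_mul_left, trajExp_const hP]
    _ ≤ 1 + (-(2 * τ) * (C * q) + τ ^ 2 * (2 * (C * r) ^ 2)) := by
      have := mul_le_mul_of_nonneg_left h1 (mul_nonneg zero_le_two hτ)
      have := mul_le_mul_of_nonneg_left h2' (sq_nonneg τ)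
      linarith
    _ = 1 - q ^ 2 / (2 * r ^ 2) := by
      simp only [τ]
      field_simp
      ring

end SecondMoment

lemma IsMarkovTraj.measureReal_collision {S Ω : Type*} [Fintype S] [DecidableEq S]
    [MeasurableSpace S] [MeasurableSingletonClass S] [MeasurableSpace Ω]
    {μ : Measure Ω} [IsProbabilityMeasure μ] {P : Matrix S S ℝ} {x : S} {X : ℕ → Ω → S}
    (hX : IsMarkovTraj μ P X) (hmeas : ∀ n, Measurable (X n)) (hstart : μ {ω | X 0 ω = x} = 1)
    (n : ℕ) :
    μ.real {ω | ∃ i j, i < j ∧ j ≤ n ∧ X i ω = X j ω} = 1 - trajExp P n x (noCollision n) := by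
  have hset : MeasurableSet {ω | ∃ i j, i < j ∧ j ≤ n ∧ X i ω = X j ω} := by
    simp only [Set.ofPred_exists, Set.ofPred_and]
    exact .iUnion fun i => .iUnion fun j => (MeasurableSet.const _).inter <|
      (MeasurableSet.const _).inter <| measurableSet_eq_fun (hmeas i) (hmeas j)
  have hcompl := probReal_compl_eq_one_sub (μ := μ) hset
  rw [← hX.integral_eq_trajExp hmeas hstart n _ fun w w' => noCollision_congr]
  have : (fun ω => noCollision n fun i => X i ω) =
      {ω | ∃ i j, i < j ∧ j ≤ n ∧ X i ω = X j ω}ᶜ.indicator 1 := by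
    funext ω
    by_cases h : ∃ i j, i < j ∧ j ≤ n ∧ X i ω = X j ω
    · rw [noCollision, if_pos h, Set.indicator_of_notMem (not_not.2 h)]
    · rw [noCollision, if_neg h, Set.indicator_of_mem h, Pi.one_apply]
  rw [this, integral_indicator_one hset.compl, hcompl, sub_sub_cancel]

theorem improved_birthday_paradox_markov
    {S : Type*} [Fintype S] [DecidableEq S] [Nonempty S]
    [MeasurableSpace S] [MeasurableSingletonClass S]
    {Ω : Type*} [MeasurableSpace Ω] (μ : Measure Ω) [IsProbabilityMeasure μ]
    (P : Matrix S S ℝ)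
    (hnonneg : ∀ u v, 0 ≤ P u v)
    (hrow : ∀ u, ∑ v, P u v = 1)
    (hcol : ∀ v, ∑ u, P u v = 1)
    (hergodic : ∃ n : ℕ, ∀ u v, 0 < (P ^ n) u v)
    (N : ℕ) (hN : N = Fintype.card S)
    (T : ℕ) (m M : ℝ) (hm0 : 0 < m) (hm1 : m ≤ 1) (hM : 1 ≤ M)
    (hPT : ∀ u v, m / N ≤ (P ^ T) u v ∧ (P ^ T) u v ≤ M / N)
    (x0 : S) (X : ℕ → Ω → S)
    (hmeas : ∀ n, Measurable (X n))
    (hstart : μ {ω | X 0 ω = x0} = 1)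
    (hmarkov : IsMarkovTraj μ P X)
    (c : ℕ) (hc : 0 < c)
    (n : ℕ)
    (hn : 2 * (c : ℝ) *
        (Real.sqrt ((1 + ∑ j ∈ Finset.Icc 1 (2 * T), 3 * (j : ℝ) * (⨆ u, ⨆ v, (P ^ j) u v))
            * ((N : ℝ) / M)) + T) ≤ n) :
    ENNReal.ofReal (1 - (1 - m ^ 2 / (2 * M ^ 2)) ^ c) ≤
      μ {ω | ∃ i j, i < j ∧ j ≤ n ∧ X i ω = X j ω} := by
  have hP : P ∈ Matrix.rowStochastic ℝ S := Matrix.mem_rowStochastic_iff_sum.2 ⟨hnonneg, hrow⟩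
  have hM0 : 0 < M := one_pos.trans_le hM
  have hN0 : (0 : ℝ) < N := by
    rw [hN]
    exact_mod_cast Fintype.card_pos
  set p : ℕ → ℝ := fun s => ⨆ u, ⨆ v, (P ^ s) u v
  have hPp (s : ℕ) (u v : S) : (P ^ s) u v ≤ p s :=
    (le_ciSup (f := fun v => (P ^ s) u v) (Set.finite_range _).bddAbove v).trans
      (le_ciSup (f := fun u => ⨆ v, (P ^ s) u v) (Set.finite_range _).bddAbove u)
  have hp (s : ℕ) : 0 ≤ p s :=
    (Matrix.nonneg_of_mem_rowStochastic (pow_mem hP s)).trans (hPp s x0 x0)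
  have hp0 : p 0 ≤ 1 := ciSup_le fun u => ciSup_le fun v =>
    Matrix.le_one_of_mem_rowStochastic (pow_mem hP 0)
  set A : ℝ := 1 + ∑ j ∈ Icc 1 (2 * T), 3 * (j : ℝ) * p j with hA_def
  have hA : 1 ≤ A := le_add_of_nonneg_right <|
    sum_nonneg fun j _ => mul_nonneg (by positivity) (hp j)
  set s : ℝ := √(A * (N / M))
  have hs : 0 < s := Real.sqrt_pos.2 (by positivity)
  have hθ : 0 ≤ 1 - m ^ 2 / (2 * M ^ 2) := by
    rw [sub_nonneg, div_le_one (by positivity)]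
    nlinarith
  rcases Nat.eq_zero_or_pos T with rfl | hT
  · have hsub : Subsingleton S := by
      refine ⟨fun u v => by_contra fun huv => ?_⟩
      have := (hPT u v).1
      rw [pow_zero, Matrix.one_apply_ne huv] at this
      exact absurd this (not_le.2 (by positivity))
    have hn1 : 1 ≤ n := by
      have : (0 : ℝ) < n := hn.trans_lt' (by positivity)
      exact_mod_cast this
    have huniv : {ω | ∃ i j, i < j ∧ j ≤ n ∧ X i ω = X j ω} = Set.univ :=
      Set.eq_univ_of_forall fun ω => ⟨0, 1, one_pos, hn1, Subsingleton.elim _ _⟩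
    rw [huniv, measure_univ, ← ENNReal.ofReal_one]
    exact ENNReal.ofReal_le_ofReal (sub_le_self _ (pow_nonneg hθ c))
  set K := ⌊2 * s⌋₊
  have hLn : c * (2 * T + K) ≤ n := by
    have hK : (K : ℝ) ≤ 2 * s := Nat.floor_le (by positivity)
    have : (c : ℝ) * (2 * T + K) ≤ n := hn.trans' <| by
      have := mul_le_mul_of_nonneg_left hK (Nat.cast_nonneg (α := ℝ) c)
      linarith
    exact_mod_cast this
  have hcard : 2 * A ≤ M / N * #(orderedPairs (K + 1)) := by
    have h1 : 2 * s < (K + 1 : ℕ) := by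
      push_cast
      exact Nat.lt_floor_add_one _
    have h2 : ((K + 1 : ℕ) : ℝ) ^ 2 ≤ 2 * #(orderedPairs (K + 1)) := by
      exact_mod_cast sq_le_two_mul_card_orderedPairs (K + 1)
    have h3 : s ^ 2 = A * (N / M) := Real.sq_sqrt (by positivity)
    have h4 : 2 * (A * (N / M)) ≤ #(orderedPairs (K + 1)) := by nlinarith
    calc 2 * A = M / N * (2 * (A * (N / M))) := by field_simp
      _ ≤ _ := mul_le_mul_of_nonneg_left h4 (by positivity)
  have hK : p 0 + ∑ s ∈ Icc 1 (2 * T), 6 * (s : ℝ) * p s ≤ M / N * #(orderedPairs (K + 1)) := by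
    have : ∑ s ∈ Icc 1 (2 * T), 6 * (s : ℝ) * p s = 2 * ∑ j ∈ Icc 1 (2 * T), 3 * (j : ℝ) * p j := by
      rw [mul_sum]
      exact sum_congr rfl fun j _ => by ring
    linarith
  have hblock := trajExp_noCollision_le hP hT (div_pos hM0 hN0) (fun u v => (hPT u v).1)
    (by positivity) (fun u v => (hPT u v).2) hp hPp K hK
  have hratio : (m / N) ^ 2 / (2 * (M / N) ^ 2) = m ^ 2 / (2 * M ^ 2) := by field_simp
  rw [hratio] at hblock
  rw [ENNReal.ofReal_le_iff_le_toReal (measure_ne_top μ _), ← measureReal_def]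
  calc _ ≤ 1 - trajExp P (c * (2 * T + K)) x0 (noCollision (c * (2 * T + K))) :=
        sub_le_sub_left (trajExp_noCollision_pow_le hP hblock c x0) 1
    _ = _ := (hmarkov.measureReal_collision hmeas hstart _).symm
    _ ≤ _ := by
        refine measureReal_mono (Set.ofPred_subset_ofPred.2 ?_)
        rintro ω ⟨i, j, hij, hj, h⟩
        exact ⟨i, j, hij, hj.trans hLn, h⟩
end
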